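/- arXiv:1401.0495 — 6 statements merged into one kernel-verified Lean document; each statement's English description precedes it below -/
import Mathlib

section
/- Assume there exists a finite-rank strong subgroup X₀ of K^×. Then for every finite-rank root-closed subgroup Y of K^× with X₀ ⊆ Y there exists a finite-rank root-closed strong subgroup S of K^× with Y ⊆ S such that S ⊆ S′ for every finite-rank root-closed strong subgroup S′ of K^× with Y ⊆ S′. (Existence of the strong closure.) -/
noncomputable section

namespace GreenPoints

variable {K : Type*} [Field K] [CharZero K]

/-- The rank of a (multiplicative) subgroup of `Kˣ`: the ℤ-module rank of the
underlying abelian group, i.e. the dimension over ℚ of `S ⊗ ℚ`. -/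
def grpRank (S : Subgroup Kˣ) : Cardinal := Module.rank ℤ (Additive S)

/-- A subgroup of `Kˣ` has finite rank. -/
def FiniteRank (S : Subgroup Kˣ) : Prop := grpRank S < Cardinal.aleph0

/-- The transcendence degree over ℚ of the subfield of `K` generated by a subset `s` of `K`:
the supremum of the cardinalities of subsets of `s` that are algebraically
independent over ℚ. -/
def tdSet (s : Set K) : Cardinal :=
  ⨆ t : {t : Set K // t ⊆ s ∧ AlgebraicIndependent ℚ ((↑) : t → K)}, Cardinal.mk t.1

/-- The transcendence degree over ℚ of the subfield of `K` generated by a subgroup of `Kˣ`. -/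
def td (S : Subgroup Kˣ) : Cardinal := tdSet (Units.val '' (S : Set Kˣ))

/-- The predimension `δ(S) = 2·td(S) − rk(S ∩ G)` (with respect to the subgroup `G`
of green points). -/
def delta (G S : Subgroup Kˣ) : ℤ :=
  2 * ((td S).toNat : ℤ) - ((grpRank (S ⊓ G)).toNat : ℤ)

/-- `Y` is strong in `T` (with respect to `G`): `δ(W) ≥ δ(Y)` for every finite-rank
subgroup `W` with `Y ⊆ W ⊆ T`. -/
def StrongIn (G Y T : Subgroup Kˣ) : Prop :=
  ∀ W : Subgroup Kˣ, FiniteRank W → Y ≤ W → W ≤ T → delta G Y ≤ delta G W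

/-- `Y` is strong: strong in `Kˣ`. -/
def Strong (G Y : Subgroup Kˣ) : Prop := StrongIn G Y ⊤

/-- A subgroup `S` of `Kˣ` is root-closed: `x ∈ S` whenever `x^n ∈ S` for some `n ≥ 1`. -/
def RootClosed (S : Subgroup Kˣ) : Prop :=
  ∀ (x : Kˣ) (n : ℕ), 1 ≤ n → x ^ n ∈ S → x ∈ S

/-- The subfield of `K` generated by a subgroup of `Kˣ`. -/
def fieldOf (S : Subgroup Kˣ) : Subfield K := Subfield.closure (Units.val '' (S : Set Kˣ))


/-! ### Ranks of subgroups -/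

/-- A subgroup of `Kˣ` as a `ℤ`-submodule of `Additive Kˣ`. -/
def subMod : Subgroup Kˣ ≃o Submodule ℤ (Additive Kˣ) :=
  Subgroup.toAddSubgroup.trans AddSubgroup.toIntSubmodule

theorem mem_subMod (S : Subgroup Kˣ) (x : Additive Kˣ) :
    x ∈ subMod S ↔ x.toMul ∈ S := Iff.rfl

theorem grpRank_eq (S : Subgroup Kˣ) : grpRank S = Module.rank ℤ (subMod S) := by
  let e : Additive S ≃+ subMod S :=
    { toFun := fun x => ⟨Additive.ofMul (x.toMul : Kˣ), x.toMul.2⟩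
      invFun := fun x => Additive.ofMul ⟨x.1.toMul, x.2⟩
      left_inv := fun _ => rfl
      right_inv := fun _ => rfl
      map_add' := fun _ _ => rfl }
  exact e.toIntLinearEquiv.rank_eq

theorem grpRank_mono {A B : Subgroup Kˣ} (h : A ≤ B) : grpRank A ≤ grpRank B := by
  rw [grpRank_eq, grpRank_eq]
  exact Submodule.rank_mono (subMod.monotone h)

theorem FiniteRank.mono {A B : Subgroup Kˣ} (hB : FiniteRank B) (h : A ≤ B) : FiniteRank A :=
  lt_of_le_of_lt (grpRank_mono h) hB

theorem grpRank_sup_inf (A B : Subgroup Kˣ) :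
    grpRank (A ⊔ B) + grpRank (A ⊓ B) = grpRank A + grpRank B := by
  rw [grpRank_eq, grpRank_eq, grpRank_eq, grpRank_eq, OrderIso.map_sup, OrderIso.map_inf]
  exact Submodule.rank_sup_add_rank_inf_eq (subMod A) (subMod B)

theorem FiniteRank.sup {A B : Subgroup Kˣ} (hA : FiniteRank A) (hB : FiniteRank B) :
    FiniteRank (A ⊔ B) := by
  have h := grpRank_sup_inf A B
  have h2 : grpRank A + grpRank B < Cardinal.aleph0 := Cardinal.add_lt_aleph0 hA hB
  rw [← h] at h2
  exact lt_of_le_of_lt (self_le_add_right _ _) h2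

theorem exists_pow_of_zpow {A : Subgroup Kˣ} {x : Kˣ} {a : ℤ} (ha : a ≠ 0) (h : x ^ a ∈ A) :
    ∃ n : ℕ, 1 ≤ n ∧ x ^ n ∈ A := by
  refine ⟨a.natAbs, Int.natAbs_pos.mpr ha, ?_⟩
  rcases Int.natAbs_eq a with h' | h'
  · rw [h', zpow_natCast] at h
    exact h
  · rw [h', zpow_neg, zpow_natCast] at h
    exact inv_mem_iff.mp h

theorem rank_quot (A B : Subgroup Kˣ) (h : A ≤ B) :
    Module.rank ℤ (subMod B ⧸ (subMod A).submoduleOf (subMod B)) + grpRank A = grpRank B := by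
  rw [grpRank_eq, grpRank_eq, ← Submodule.rank_quotient_add_rank
    ((subMod A).submoduleOf (subMod B))]
  congr 1
  exact (Submodule.submoduleOfEquivOfLe (subMod.monotone h)).rank_eq.symm

theorem pow_mem_of_grpRank_eq {A B : Subgroup Kˣ} (h : A ≤ B) (hB : FiniteRank B)
    (hr : grpRank B ≤ grpRank A) {x : Kˣ} (hx : x ∈ B) : ∃ n : ℕ, 1 ≤ n ∧ x ^ n ∈ A := by
  have h1 := rank_quot A B h
  rw [le_antisymm hr (grpRank_mono h)] at h1
  have h0 : Module.rank ℤ (subMod B ⧸ (subMod A).submoduleOf (subMod B)) = 0 := by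
    have hA : grpRank A < Cardinal.aleph0 := hB.mono h
    refine Cardinal.eq_of_add_eq_add_right (b := grpRank A) ?_ hA
    rw [h1, zero_add]
  rw [rank_eq_zero_iff] at h0
  obtain ⟨a, ha, hax⟩ := h0 (Submodule.Quotient.mk ⟨Additive.ofMul x, hx⟩)
  rw [← Submodule.Quotient.mk_smul, Submodule.Quotient.mk_eq_zero] at hax
  exact exists_pow_of_zpow ha hax

theorem grpRank_eq_of_pow_mem {A B : Subgroup Kˣ} (h : A ≤ B)
    (hx : ∀ x ∈ B, ∃ n : ℕ, 1 ≤ n ∧ x ^ n ∈ A) : grpRank B = grpRank A := by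
  rw [← rank_quot A B h]
  have h0 : Module.rank ℤ (subMod B ⧸ (subMod A).submoduleOf (subMod B)) = 0 := by
    rw [rank_eq_zero_iff]
    intro y
    obtain ⟨y, rfl⟩ := Submodule.Quotient.mk_surjective _ y
    obtain ⟨n, hn, hxn⟩ := hx y.1.toMul y.2
    refine ⟨n, by exact_mod_cast Nat.one_le_iff_ne_zero.mp hn, ?_⟩
    rw [← Submodule.Quotient.mk_smul, Submodule.Quotient.mk_eq_zero]
    change y.1.toMul ^ (n : ℤ) ∈ A
    simpa using hxn
  rw [h0, zero_add]

/-! ### Transcendence degree -/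

/-- The algebraic independence matroid. -/
abbrev mat (K : Type*) [Field K] [CharZero K] : Matroid K := AlgebraicIndependent.matroid ℚ K

theorem tdSet_eq (s : Set K) : tdSet s = (mat K).cRk s := by
  rw [Matroid.cRk, Matroid.cRank_eq_iSup_cardinalMk_indep, tdSet]
  refine Equiv.iSup_congr (Equiv.subtypeEquivRight fun t => ?_) fun _ => rfl
  rw [Matroid.restrict_indep_iff, and_comm]
  rfl

/-- The `ℕ∞`-valued transcendence degree. -/
def etd (S : Subgroup Kˣ) : ℕ∞ := (mat K).eRk (Units.val '' (S : Set Kˣ))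

theorem td_toNat (S : Subgroup Kˣ) : (td S).toNat = (etd S).toNat := by
  rw [td, tdSet_eq, etd, ← Matroid.toENat_cRk_eq, Cardinal.toNat_toENat]

/-- Units algebraic over a set, as a subgroup. -/
def cloGrp (X : Set K) : Subgroup Kˣ where
  carrier := {u | IsAlgebraic (Algebra.adjoin ℚ X) (u : K)}
  mul_mem' := fun {a b} ha hb => by
    have := IsAlgebraic.mul (R := Algebra.adjoin ℚ X) ha hb
    simpa using this
  one_mem' := by
    simpa using (isAlgebraic_one : IsAlgebraic (Algebra.adjoin ℚ X) (1 : K))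
  inv_mem' := fun {a} ha => by
    have := IsAlgebraic.inv (R := Algebra.adjoin ℚ X) ha
    simpa using this

theorem mem_cloGrp_iff {X : Set K} {u : Kˣ} :
    u ∈ cloGrp X ↔ (u : K) ∈ (mat K).closure X := by
  rw [AlgebraicIndependent.matroid_closure_eq, SetLike.mem_coe, Subalgebra.mem_algebraicClosure]
  rfl

theorem rootClosed_cloGrp (X : Set K) : RootClosed (cloGrp X) := by
  intro x n hn h
  have h' : IsAlgebraic (Algebra.adjoin ℚ X) ((x ^ n : Kˣ) : K) := h
  rw [Units.val_pow_eq_pow_val] at h'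
  exact h'.of_pow hn

theorem mem_cloGrp {X : Set K} {u : Kˣ} (h : (u : K) ∈ X) : u ∈ cloGrp X := by
  rw [mem_cloGrp_iff]
  exact (mat K).subset_closure X (Set.subset_univ _) h

theorem etd_le {S : Subgroup Kˣ} {X : Set K} (h : S ≤ cloGrp X) : etd S ≤ (mat K).eRk X := by
  rw [etd, ← Matroid.eRk_closure_eq _ X]
  apply Matroid.eRk_mono
  rintro _ ⟨u, hu, rfl⟩
  exact mem_cloGrp_iff.mp (h hu)

theorem etd_mono {A B : Subgroup Kˣ} (h : A ≤ B) : etd A ≤ etd B :=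
  (mat K).eRk_mono (Set.image_mono h)

theorem le_cloGrp (S : Subgroup Kˣ) : S ≤ cloGrp (Units.val '' (S : Set Kˣ)) :=
  fun _ hu => mem_cloGrp ⟨_, hu, rfl⟩

theorem cloGrp_mono {X Y : Set K} (h : X ⊆ Y) : cloGrp X ≤ cloGrp Y := by
  intro u hu
  rw [mem_cloGrp_iff] at hu ⊢
  exact (mat K).closure_subset_closure h hu

theorem etd_ne_top {S : Subgroup Kˣ} (hS : FiniteRank S) : etd S ≠ ⊤ := by
  obtain ⟨s, hs, hli⟩ := exists_set_linearIndependent ℤ (subMod S)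
  have hfin : s.Finite := by
    rw [← Cardinal.lt_aleph0_iff_set_finite, hs, ← grpRank_eq]
    exact hS
  have hq := Submodule.rank_quotient_add_rank (Submodule.span ℤ s)
  rw [rank_span_set hli, hs] at hq
  have h0 : Module.rank ℤ (subMod S ⧸ Submodule.span ℤ s) = 0 := by
    refine Cardinal.eq_of_add_eq_add_right (b := grpRank S) ?_ hS
    rw [zero_add, grpRank_eq, hq]
  rw [rank_eq_zero_iff] at h0
  let X : Set K := (fun y : subMod S => ((y.1.toMul : Kˣ) : K)) '' s
  have hX : X.Finite := hfin.image _
  have hspan : ∀ y ∈ Submodule.span ℤ s, y.1.toMul ∈ cloGrp X := by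
    have hle : Submodule.span ℤ s ≤ (subMod (cloGrp X)).submoduleOf (subMod S) := by
      rw [Submodule.span_le]
      intro y hy
      exact mem_cloGrp ⟨y, hy, rfl⟩
    exact fun y hy => hle hy
  have hle : S ≤ cloGrp X := by
    intro x hx
    obtain ⟨a, ha, hax⟩ := h0 (Submodule.Quotient.mk ⟨Additive.ofMul x, hx⟩)
    rw [← Submodule.Quotient.mk_smul, Submodule.Quotient.mk_eq_zero] at hax
    obtain ⟨n, hn, h⟩ := exists_pow_of_zpow (x := x) ha (hspan _ hax)
    exact rootClosed_cloGrp X x n hn h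
  have h1 := (etd_le hle).trans ((mat K).eRk_le_encard X)
  exact ne_top_of_le_ne_top hX.encard_lt_top.ne h1

theorem etd_submod (A B : Subgroup Kˣ) : etd (A ⊓ B) + etd (A ⊔ B) ≤ etd A + etd B := by
  refine le_trans (add_le_add ?_ ?_) ((mat K).eRk_inter_add_eRk_union_le
    (Units.val '' (A : Set Kˣ)) (Units.val '' (B : Set Kˣ)))
  · apply (mat K).eRk_mono
    rintro _ ⟨u, hu, rfl⟩
    exact ⟨⟨u, hu.1, rfl⟩, ⟨u, hu.2, rfl⟩⟩
  · apply etd_le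
    exact sup_le ((le_cloGrp A).trans (cloGrp_mono Set.subset_union_left))
      ((le_cloGrp B).trans (cloGrp_mono Set.subset_union_right))

/-! ### Predimension -/

theorem delta_submod (G : Subgroup Kˣ) {A B : Subgroup Kˣ} (hA : FiniteRank A)
    (hB : FiniteRank B) :
    delta G (A ⊓ B) + delta G (A ⊔ B) ≤ delta G A + delta G B := by
  have hs : FiniteRank (A ⊔ B) := hA.sup hB
  have hi : FiniteRank (A ⊓ B) := hA.mono inf_le_left
  have h1 : (td (A ⊓ B)).toNat + (td (A ⊔ B)).toNat ≤ (td A).toNat + (td B).toNat := by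
    have h := etd_submod A B
    simp only [td_toNat]
    rw [← ENat.natCast_toNat (etd_ne_top hA), ← ENat.natCast_toNat (etd_ne_top hB),
      ← ENat.natCast_toNat (etd_ne_top hs), ← ENat.natCast_toNat (etd_ne_top hi)] at h
    exact_mod_cast h
  have h2 : (grpRank (A ⊓ G)).toNat + (grpRank (B ⊓ G)).toNat ≤
      (grpRank ((A ⊓ B) ⊓ G)).toNat + (grpRank ((A ⊔ B) ⊓ G)).toNat := by
    have fA : FiniteRank (A ⊓ G) := hA.mono inf_le_left
    have fB : FiniteRank (B ⊓ G) := hB.mono inf_le_left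
    have fi : FiniteRank ((A ⊓ B) ⊓ G) := hi.mono inf_le_left
    have fs : FiniteRank ((A ⊔ B) ⊓ G) := hs.mono inf_le_left
    rw [← Cardinal.toNat_add fA fB, ← Cardinal.toNat_add fi fs, ← grpRank_sup_inf]
    refine Cardinal.toNat_le_toNat ?_ (Cardinal.add_lt_aleph0 fi fs)
    rw [add_comm]
    refine add_le_add (grpRank_mono ?_) (grpRank_mono ?_)
    · exact le_inf (inf_le_inf inf_le_left inf_le_left) (inf_le_left.trans inf_le_right)
    · exact sup_le (inf_le_inf_right _ le_sup_left) (inf_le_inf_right _ le_sup_right)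
  simp only [delta]
  omega

theorem Strong.delta_inf_le {G S W : Subgroup Kˣ} (hS : FiniteRank S) (hs : Strong G S)
    (hW : FiniteRank W) : delta G (W ⊓ S) ≤ delta G W := by
  have h1 := delta_submod G hW hS
  have h2 := hs (W ⊔ S) (hW.sup hS) le_sup_right le_top
  omega

theorem Strong.inf {G S T : Subgroup Kˣ} (hS : FiniteRank S) (hs : Strong G S)
    (hT : FiniteRank T) (ht : Strong G T) : Strong G (S ⊓ T) := by
  intro W hW hle _
  have h1 := hs.delta_inf_le hS hW
  have h2 := ht.delta_inf_le hT (hW.mono (inf_le_left : W ⊓ S ≤ W))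
  rw [inf_assoc, inf_eq_right.mpr hle] at h2
  exact h2.trans h1

/-- The root closure of a subgroup. -/
def rootCl (W : Subgroup Kˣ) : Subgroup Kˣ where
  carrier := {x | ∃ n : ℕ, 1 ≤ n ∧ x ^ n ∈ W}
  mul_mem' := by
    rintro a b ⟨n, hn, ha⟩ ⟨m, hm, hb⟩
    refine ⟨n * m, Nat.mul_pos hn hm, ?_⟩
    rw [mul_pow, pow_mul, mul_comm n m, pow_mul b]
    exact mul_mem (pow_mem ha m) (pow_mem hb n)
  one_mem' := ⟨1, le_rfl, by simp [one_mem]⟩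
  inv_mem' := by
    rintro a ⟨n, hn, ha⟩
    exact ⟨n, hn, by rw [inv_pow]; exact inv_mem ha⟩

theorem le_rootCl (W : Subgroup Kˣ) : W ≤ rootCl W := fun x hx => ⟨1, le_rfl, by simpa using hx⟩

theorem rootClosed_rootCl (W : Subgroup Kˣ) : RootClosed (rootCl W) := by
  rintro x n hn ⟨m, hm, h⟩
  exact ⟨n * m, Nat.mul_pos hn hm, by rwa [pow_mul]⟩

theorem finiteRank_rootCl {W : Subgroup Kˣ} (hW : FiniteRank W) : FiniteRank (rootCl W) := by
  have h := grpRank_eq_of_pow_mem (le_rootCl W) fun _ hx => hx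
  rw [FiniteRank, h]
  exact hW

theorem delta_rootCl_le (G : Subgroup Kˣ) {W : Subgroup Kˣ} (hW : FiniteRank W) :
    delta G (rootCl W) ≤ delta G W := by
  have h1 : (td (rootCl W)).toNat ≤ (td W).toNat := by
    rw [td_toNat, td_toNat]
    refine ENat.toNat_le_toNat (etd_le ?_) (etd_ne_top hW)
    rintro x ⟨n, hn, h⟩
    exact rootClosed_cloGrp _ x n hn (le_cloGrp W h)
  have h2 : (grpRank (W ⊓ G)).toNat ≤ (grpRank (rootCl W ⊓ G)).toNat :=
    Cardinal.toNat_le_toNat (grpRank_mono (inf_le_inf_right _ (le_rootCl W)))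
      ((finiteRank_rootCl hW).mono inf_le_left)
  simp only [delta]
  omega

/-- Existence of the strong closure: if there is a finite-rank strong subgroup `X₀` of `Kˣ`,
then every finite-rank root-closed subgroup `Y ⊇ X₀` is contained in a smallest
finite-rank root-closed strong subgroup `S`. -/
theorem strong_closure_exists {K : Type*} [Field K] [CharZero K] (G X₀ : Subgroup Kˣ)
    (hX₀fr : FiniteRank X₀) (hX₀s : Strong G X₀) :
    ∀ Y : Subgroup Kˣ, FiniteRank Y → RootClosed Y → X₀ ≤ Y →
      ∃ S : Subgroup Kˣ, FiniteRank S ∧ RootClosed S ∧ Strong G S ∧ Y ≤ S ∧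
        ∀ S' : Subgroup Kˣ, FiniteRank S' → RootClosed S' → Strong G S' → Y ≤ S' →
          S ≤ S' := by
  intro Y hY hYr hXY
  -- a finite-rank root-closed strong subgroup containing `Y`
  obtain ⟨d, ⟨W, hWf, hYW, hWd⟩, hmin⟩ := Int.exists_least_of_bdd
    (P := fun z => ∃ W : Subgroup Kˣ, FiniteRank W ∧ Y ≤ W ∧ delta G W = z)
    ⟨delta G X₀, by
      rintro z ⟨W, hW, hle, rfl⟩
      exact hX₀s W hW (hXY.trans hle) le_top⟩ ⟨_, Y, hY, le_rfl, rfl⟩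
  have hex : ∃ n : ℕ, ∃ S : Subgroup Kˣ, (FiniteRank S ∧ RootClosed S ∧ Strong G S ∧ Y ≤ S) ∧
      (grpRank S).toNat = n := by
    refine ⟨_, rootCl W, ⟨finiteRank_rootCl hWf, rootClosed_rootCl W, ?_,
      hYW.trans (le_rootCl W)⟩, rfl⟩
    intro V hV hle _
    have h1 := hmin _ ⟨V, hV, (hYW.trans (le_rootCl W)).trans hle, rfl⟩
    have h2 := delta_rootCl_le G hWf
    omega
  classical
  obtain ⟨S, ⟨hSf, hSr, hSs, hYS⟩, hSn⟩ := Nat.find_spec hex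
  refine ⟨S, hSf, hSr, hSs, hYS, ?_⟩
  intro S' hf' hr' hs' hY'
  have hif : FiniteRank (S ⊓ S') := hSf.mono inf_le_left
  have hm := Nat.find_min' hex ⟨S ⊓ S', ⟨hif,
    fun x n hn h => ⟨hSr x n hn h.1, hr' x n hn h.2⟩, hSs.inf hSf hf' hs',
    le_inf hYS hY'⟩, rfl⟩
  rw [← hSn] at hm
  have hr : grpRank S ≤ grpRank (S ⊓ S') := (Cardinal.toNat_le_iff_le_of_lt_aleph0 hSf hif).mp hm
  intro x hx
  obtain ⟨n, hn, h⟩ := pow_mem_of_grpRank_eq inf_le_left hSf hr hx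
  exact hr' x n hn h.2

end GreenPoints

end
end

section
/- Let Y be a finite-rank root-closed strong subgroup of K^×, and let Z := {x ∈ K^× : x is algebraic over the subfield of K generated by Y} (a subgroup of K^×). Then every finite-rank subgroup Y′ of K^× with Y ⊆ Y′ ⊆ Z is strong. (Strongness propagates to finite-rank extensions inside the algebraic closure.) -/
noncomputable section

namespace GreenPoints

variable {K : Type*} [Field K] [CharZero K]

theorem isAlgebraic_adjoin_of_fieldOf {K : Type*} [Field K] [CharZero K] (Y : Subgroup Kˣ) (x : K)
    (h : IsAlgebraic (fieldOf Y) x) :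
    IsAlgebraic (Algebra.adjoin ℚ (Units.val '' (Y : Set Kˣ))) x := by
  rw [← IntermediateField.isAlgebraic_adjoin_iff]
  have hle : fieldOf Y ≤ (IntermediateField.adjoin ℚ (Units.val '' (Y : Set Kˣ))).toSubfield :=
    Subfield.closure_le.mpr (IntermediateField.subset_adjoin ℚ _)
  let i : fieldOf Y →+* IntermediateField.adjoin ℚ (Units.val '' (Y : Set Kˣ)) :=
    Subfield.inclusion hle
  let : Algebra (fieldOf Y) (IntermediateField.adjoin ℚ (Units.val '' (Y : Set Kˣ))) :=
    i.toAlgebra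
  have : IsScalarTower (fieldOf Y)
      (IntermediateField.adjoin ℚ (Units.val '' (Y : Set Kˣ))) K :=
    .of_algebraMap_eq fun _ => rfl
  exact h.extendScalars i.injective

theorem tdSet_eq_cRk {K : Type*} [Field K] [CharZero K] (s : Set K) :
    tdSet s = (AlgebraicIndependent.matroid ℚ K).cRk s := by
  apply le_antisymm
  · exact ciSup_le' fun t =>
      Matroid.Indep.cardinalMk_le_cRk_of_subset
        (AlgebraicIndependent.matroid_indep_iff.mpr t.2.2) t.2.1
  · rw [Matroid.cRk_le_iff]
    intro I hI
    exact le_ciSup (f := fun t : {t : Set K // t ⊆ s ∧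
      AlgebraicIndependent ℚ ((↑) : t → K)} => Cardinal.mk t.1)
      Cardinal.bddAbove_of_small ⟨I, hI.subset, AlgebraicIndependent.matroid_indep_iff.mp hI.indep⟩

theorem grpRank_mono_s8 {K : Type*} [Field K] {S T : Subgroup Kˣ} (h : S ≤ T) :
    grpRank S ≤ grpRank T :=
  LinearMap.rank_le_of_injective (MonoidHom.toAdditive (Subgroup.inclusion h)).toIntLinearMap
    (Subgroup.inclusion_injective h)

theorem td_eq {K : Type*} [Field K] [CharZero K] {Y Y' : Subgroup Kˣ} (hle : Y ≤ Y')
    (h : ∀ x : Kˣ, x ∈ Y' → IsAlgebraic (fieldOf Y) (x : K)) : td Y' = td Y := by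
  unfold td
  rw [tdSet_eq_cRk, tdSet_eq_cRk]
  apply le_antisymm
  · rw [← Matroid.cRk_closure _ (Units.val '' (Y : Set Kˣ))]
    apply Matroid.cRk_le_of_subset
    rw [AlgebraicIndependent.matroid_closure_eq]
    rintro _ ⟨x, hx, rfl⟩
    exact isAlgebraic_adjoin_of_fieldOf Y _ (h x hx)
  · exact Matroid.cRk_le_of_subset _ (Set.image_mono hle)

/-- Strongness propagates to finite-rank extensions inside the algebraic closure:
if `Y` is a finite-rank root-closed strong subgroup of `Kˣ`, then every finite-rank
subgroup `Y′ ⊇ Y` all of whose elements are algebraic over the subfield generated by `Y`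
is strong. -/
theorem strong_of_le_algebraicClosure {K : Type*} [Field K] [CharZero K] (G Y : Subgroup Kˣ)
    (hfr : FiniteRank Y) (hrc : RootClosed Y) (hs : Strong G Y) :
    ∀ Y' : Subgroup Kˣ, FiniteRank Y' → Y ≤ Y' →
      (∀ x : Kˣ, x ∈ Y' → IsAlgebraic (fieldOf Y) (x : K)) →
      Strong G Y' := by
  intro Y' hfr' hle halg W hW hYW _
  refine le_trans ?_ (hs W hW (hle.trans hYW) le_top)
  unfold delta
  rw [td_eq hle halg]
  have h1 : (grpRank (Y ⊓ G)).toNat ≤ (grpRank (Y' ⊓ G)).toNat :=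
    Cardinal.toNat_le_toNat (grpRank_mono_s8 (inf_le_inf_right G hle))
      ((grpRank_mono_s8 inf_le_left).trans_lt hfr')
  omega

end GreenPoints

end
end

section
/- Let K be an algebraically closed field of characteristic zero, F a subfield of K, n ≥ 1, a ∈ (K^×)^n and c ∈ K^n such that ∑_{i=1}^n c_i·a_i = 1, the coordinates of c are algebraically independent over F (i.e. trdeg(c/F) = n), and trdeg(c/F(a)) = n − 1. Then for every finite tuple b of elements of K each algebraic over F(a): if trdeg(b/F(c)) < trdeg(b/F), then every coordinate a_i is algebraic over F(b). -/
noncomputable section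

/-- The transcendence degree over a subfield `F` of `K` of the subfield `F(s)` generated by
`F` and a subset `s` of `K`: the supremum of the cardinalities of subsets of `s` that are
algebraically independent over `F`. -/
def trdegOver {K : Type*} [Field K] (F : Subfield K) (s : Set K) : Cardinal :=
  ⨆ t : {t : Set K // t ⊆ s ∧ AlgebraicIndependent F ((↑) : t → K)}, Cardinal.mk t.1

/-- The subfield `F(s)` of `K` generated by a subfield `F` and a subset `s` of `K`. -/
def Subfield.adjoinSet {K : Type*} [Field K] (F : Subfield K) (s : Set K) : Subfield K :=
  Subfield.closure ((F : Set K) ∪ s)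

/-- Transfer of algebraic independence along an inclusion of subsets of `K`. -/
theorem algInd_of_sub {K R S ι : Type*} [CommRing K] [CommRing R] [CommRing S] [Algebra R K]
    [Algebra S K] (hR : Function.Injective (algebraMap R K))
    (h : ∀ r : R, ∃ s : S, algebraMap S K s = algebraMap R K r)
    (hS : Function.Injective (algebraMap S K)) {x : ι → K}
    (hx : AlgebraicIndependent S x) : AlgebraicIndependent R x := by
  choose f hf using h
  let g : R →+* S :=
    { toFun := f
      map_one' := hS (by simp [hf])
      map_mul' := fun p q => hS (by simp [hf])
      map_zero' := hS (by simp [hf])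
      map_add' := fun p q => hS (by simp [hf]) }
  refine AlgebraicIndependent.of_ringHom_of_comp_eq (S := S) (B := K) g (RingHom.id K)
    (x := x) hx ?_ ?_
  · intro p q hpq
    apply hR
    rw [← hf, ← hf]
    exact congrArg _ hpq
  · ext r
    exact hf r

theorem swap_ind {K : Type*} [Field K] (F : Subfield K) {ι κ : Type*} (c : ι → K) (t : κ → K)
    (s : Set K) (hts : Set.range t ⊆ s)
    (ht : AlgebraicIndependent F t) (hc : AlgebraicIndependent (F.adjoinSet s) c) :
    AlgebraicIndependent (F.adjoinSet (Set.range c)) t := by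
  have h1 : AlgebraicIndependent (Algebra.adjoin F (Set.range t)) c := by
    refine algInd_of_sub Subtype.val_injective ?_ Subtype.val_injective hc
    rintro ⟨r, hr⟩
    refine ⟨⟨r, ?_⟩, rfl⟩
    induction hr using Algebra.adjoin_induction with
    | mem x hx => exact Subfield.subset_closure (Or.inr (hts hx))
    | algebraMap r => exact Subfield.subset_closure (Or.inl r.2)
    | add x y _ _ hx hy => exact add_mem hx hy
    | mul x y _ _ hx hy => exact mul_mem hx hy
  have h2 : AlgebraicIndependent F (Sum.elim c t) := AlgebraicIndependent.sumElim_iff.2 ⟨ht, h1⟩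
  have h3 : AlgebraicIndependent F (Sum.elim t c) := by
    have := h2.comp Sum.swap Sum.swap_leftInverse.injective
    convert this using 1
    ext x; cases x <;> rfl
  have h4 := (AlgebraicIndependent.sumElim_iff.1 h3).2
  have h5 := IntermediateField.algebraicIndependent_adjoin_iff.2 h4
  refine algInd_of_sub Subtype.val_injective ?_ Subtype.val_injective h5
  rintro ⟨r, hr⟩
  refine ⟨⟨r, ?_⟩, rfl⟩
  have : F.adjoinSet (Set.range c) ≤ (IntermediateField.adjoin F (Set.range c)).toSubfield := by
    refine Subfield.closure_le.2 ?_
    rintro x (hx | hx)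
    · exact (IntermediateField.adjoin F (Set.range c)).algebraMap_mem ⟨x, hx⟩
    · exact IntermediateField.subset_adjoin _ _ hx
  exact this hr

theorem not_ind_of_lt {K : Type*} [Field K] (F : Subfield K) {ι : Type*} (c : ι → K) (s : Set K)
    (h : trdegOver (F.adjoinSet (Set.range c)) s < trdegOver F s) :
    ¬ AlgebraicIndependent (F.adjoinSet s) c := by
  intro hc
  refine absurd h (not_lt.2 ?_)
  have : Nonempty {t : Set K // t ⊆ s ∧ AlgebraicIndependent F ((↑) : t → K)} := by
    refine ⟨⟨∅, Set.empty_subset _, ?_⟩⟩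
    exact (algebraicIndependent_empty_iff _ _).2 (algebraMap F K).injective
  refine ciSup_le fun t => ?_
  refine le_ciSup_of_le Cardinal.bddAbove_of_small ⟨t.1, t.2.1, ?_⟩ le_rfl
  exact swap_ind F c _ s (by simpa using t.2.1) t.2.2 hc

universe u in
theorem core {K L M : Type u} [Field K] [Field L] [Field M] [Algebra L K] [Algebra M K]
    [Algebra L M] [IsScalarTower L M K] [CharZero L] {n : ℕ} (a : Fin n → M) (c : Fin n → K)
    (hsum : ∑ i, c i * algebraMap M K (a i) = 1) (j : Fin n) (haj : a j ≠ 0)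
    (hc : AlgebraicIndependent M (fun i : {i // i ≠ j} => c i))
    (hcL : ¬ AlgebraicIndependent L c) (i : Fin n) : IsAlgebraic L (a i) := by
  classical
  obtain ⟨P, hP0, hP⟩ : ∃ P : MvPolynomial (Fin n) L, MvPolynomial.aeval c P = 0 ∧ P ≠ 0 := by
    rw [algebraicIndependent_iff] at hcL
    push Not at hcL
    exact hcL
  -- `P` vanishes on the hyperplane
  have hvan : ∀ x : Fin n → M, ∑ i, x i * a i = 1 → MvPolynomial.aeval x P = 0 := by
    intro x hx
    let ℓ : MvPolynomial {i // i ≠ j} M :=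
      MvPolynomial.C (a j)⁻¹ * (1 - ∑ i : {i // i ≠ j}, MvPolynomial.X i * MvPolynomial.C (a i))
    let θ : Fin n → MvPolynomial {i // i ≠ j} M :=
      fun i => if h : i ≠ j then MvPolynomial.X ⟨i, h⟩ else ℓ
    have key : ∀ (A : Type u) [Field A] [Algebra M A] (y : Fin n → A),
        ∑ i, y i * algebraMap M A (a i) = 1 →
        ∀ i, MvPolynomial.aeval (fun i : {i // i ≠ j} => y i) (θ i) = y i := by
      intro A _ _ y hy i
      by_cases h : i = j
      · subst h
        have h0 : algebraMap M A (a i) ≠ 0 := by simpa using haj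
        rw [Fintype.sum_eq_add_sum_subtype_ne _ i] at hy
        simp only [θ, ℓ, ne_eq, not_true_eq_false, dite_false, map_mul, map_sub, map_one, map_sum,
          MvPolynomial.aeval_C, MvPolynomial.aeval_X, map_inv₀]
        rw [← hy]
        field_simp
        simp
      · simp [θ, h]
    have hPθ : MvPolynomial.aeval θ P = 0 := by
      rw [algebraicIndependent_iff] at hc
      apply hc
      have := MvPolynomial.comp_aeval_apply
        ((MvPolynomial.aeval (fun i : {i // i ≠ j} => c i) : _ →ₐ[M] K).restrictScalars L) (f := θ) P
      simp only [AlgHom.restrictScalars_apply] at this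
      rw [this, ← hP0]
      congr 2
      funext i
      exact key K c hsum i
    have := MvPolynomial.comp_aeval_apply
        ((MvPolynomial.aeval (fun i : {i // i ≠ j} => x i) : _ →ₐ[M] M).restrictScalars L) (f := θ) P
    simp only [AlgHom.restrictScalars_apply] at this
    rw [hPθ, map_zero] at this
    rw [this]
    congr 2
    funext i
    exact (key M x hx i).symm
  -- generic directions
  have hgen : ∀ v : Fin n → L, MvPolynomial.eval v P ≠ 0 →
      IsAlgebraic L (∑ i, algebraMap L M (v i) * a i) := by
    intro v hv
    set s := ∑ i, algebraMap L M (v i) * a i with hs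
    by_cases hs0 : s = 0
    · rw [hs0]; exact isAlgebraic_zero
    rw [← IsAlgebraic.inv_iff]
    let Q : Polynomial L :=
      MvPolynomial.aeval (fun i => Polynomial.C (v i) * Polynomial.X) P
    refine ⟨Q, ?_, ?_⟩
    · intro hQ
      apply hv
      have := MvPolynomial.comp_aeval_apply (Polynomial.aeval (1 : L))
        (f := fun i => Polynomial.C (v i) * Polynomial.X) P
      change Polynomial.aeval (1 : L) Q = _ at this
      rw [hQ, map_zero] at this
      simp at this
      simpa [MvPolynomial.aeval_eq_eval] using this.symm
    · have := MvPolynomial.comp_aeval_apply (Polynomial.aeval (s⁻¹ : M))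
        (f := fun i => Polynomial.C (v i) * Polynomial.X) P
      change Polynomial.aeval (s⁻¹ : M) Q = _ at this
      rw [this]
      apply hvan
      simp only [map_mul, Polynomial.aeval_C, Polynomial.aeval_X]
      rw [← inv_mul_cancel₀ hs0, hs, Finset.mul_sum]
      refine Finset.sum_congr rfl fun i _ => by ring
  -- choose a generic `v`
  let τ : MvPolynomial (Fin n) L →ₐ[L] MvPolynomial (Fin n) L :=
    MvPolynomial.aeval (fun k => MvPolynomial.X k + MvPolynomial.C (if k = i then 1 else 0))
  have hτ : ∀ v (p : MvPolynomial (Fin n) L), MvPolynomial.eval v (τ p) =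
      MvPolynomial.eval (fun k => v k + if k = i then 1 else 0) p := by
    intro v p
    have := MvPolynomial.comp_aeval_apply (MvPolynomial.aeval v)
        (f := fun k => MvPolynomial.X k + MvPolynomial.C (if k = i then (1 : L) else 0)) p
    simpa [τ, MvPolynomial.aeval_eq_eval] using this
  have hτP : τ P ≠ 0 := by
    intro h
    apply hP
    apply MvPolynomial.funext
    intro x
    have := hτ (fun k => x k - if k = i then 1 else 0) P
    rw [h] at this
    simpa using this.symm
  obtain ⟨v, hv⟩ : ∃ v, MvPolynomial.eval v (P * τ P) ≠ 0 := by
    by_contra! h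
    exact mul_ne_zero hP hτP (MvPolynomial.funext fun x => by simpa using h x)
  rw [map_mul, hτ] at hv
  have h1 := hgen v (left_ne_zero_of_mul hv)
  have h2 := hgen _ (right_ne_zero_of_mul hv)
  have h3 := h2.sub h1
  have h4 : ∑ k, algebraMap L M (v k + if k = i then 1 else 0) * a k
      - ∑ k, algebraMap L M (v k) * a k = a i := by
    rw [← Finset.sum_sub_distrib]
    simp [add_mul, apply_ite (algebraMap L M)]
  rwa [h4] at h3

theorem exists_index {K : Type*} [Field K] (E : Subfield K) (n : ℕ) (hn : 1 ≤ n) (c : Fin n → K)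
    (hinj : Function.Injective c)
    (h : trdegOver E (Set.range c) = ((n - 1 : ℕ) : Cardinal)) :
    ∃ j : Fin n, AlgebraicIndependent E (fun i : {i : Fin n // i ≠ j} => c i) := by
  classical
  obtain ⟨t, hts, hti, htc⟩ : ∃ t : Set K, t ⊆ Set.range c ∧
      AlgebraicIndependent E ((↑) : t → K) ∧ Cardinal.mk t = ((n - 1 : ℕ) : Cardinal) := by
    have : Nonempty {t : Set K // t ⊆ Set.range c ∧ AlgebraicIndependent E ((↑) : t → K)} :=
      ⟨⟨∅, Set.empty_subset _, (algebraicIndependent_empty_iff _ _).2 (algebraMap E K).injective⟩⟩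
    by_contra! hcon
    have hle : ∀ t : {t : Set K // t ⊆ Set.range c ∧ AlgebraicIndependent E ((↑) : t → K)},
        Cardinal.mk t.1 < ((n - 1 : ℕ) : Cardinal) := fun t =>
      lt_of_le_of_ne (h ▸ le_ciSup (f := fun t : {t : Set K // t ⊆ Set.range c ∧
        AlgebraicIndependent E ((↑) : t → K)} => Cardinal.mk t.1) Cardinal.bddAbove_of_small t)
        (hcon t.1 t.2.1 t.2.2)
    obtain ⟨k, hk⟩ : ∃ k, n - 1 = k + 1 := by
      refine Nat.exists_eq_succ_of_ne_zero fun h0 => ?_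
      have := hle (Classical.arbitrary _)
      rw [h0] at this
      simp at this
    have : trdegOver E (Set.range c) ≤ (k : Cardinal) := by
      refine ciSup_le fun t => ?_
      have := hle t
      rw [hk] at this
      rw [← Order.lt_succ_iff]
      simpa using this
    rw [h, hk] at this
    have := Nat.cast_le.1 this
    omega
  have hncard : t.ncard = n - 1 := by
    have := congrArg Cardinal.toNat htc
    rwa [Cardinal.toNat_natCast] at this
  have hne : ∃ j, c j ∉ t := by
    by_contra! hall
    have : t = Set.range c := Set.Subset.antisymm hts (by rintro _ ⟨i, rfl⟩; exact hall i)
    rw [this, ← Set.image_univ, Set.ncard_image_of_injective _ hinj, Set.ncard_univ,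
      Nat.card_fin] at hncard
    omega
  obtain ⟨j, hj⟩ := hne
  have hmem : ∀ i, i ≠ j → c i ∈ t := by
    intro i hi
    by_contra hit
    have hsub : t ⊆ c '' (((Finset.univ.erase i).erase j : Finset (Fin n)) : Set (Fin n)) := by
      intro x hx
      obtain ⟨k, rfl⟩ := hts hx
      refine ⟨k, ?_, rfl⟩
      simp
      constructor
      · intro h; exact hit (h ▸ hx)
      · intro h; exact hj (h ▸ hx)
    have h2 := Set.ncard_le_ncard hsub (Set.toFinite _)
    rw [hncard, Set.ncard_image_of_injective _ hinj, Set.ncard_coe_finset,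
      Finset.card_erase_of_mem (by simp [hi.symm]), Finset.card_erase_of_mem (by simp)] at h2
    simp at h2
    have := i.2
    have := j.2
    have : (i : ℕ) ≠ j := fun h => hi (Fin.ext h)
    omega
  refine ⟨j, ?_⟩
  exact hti.comp (fun i : {i // i ≠ j} => (⟨c i, hmem i i.2⟩ : t)) (by
    intro p q hpq
    exact Subtype.ext (hinj (congrArg Subtype.val hpq)))

/-- Let `a ∈ (K^×)^n` and `c ∈ K^n` with `∑ cᵢ·aᵢ = 1`, the coordinates of `c` algebraically
independent over `F`, and `trdeg(c/F(a)) = n − 1`. Then for every finite tuple `b` of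
elements algebraic over `F(a)`: if `trdeg(b/F(c)) < trdeg(b/F)`, then every `aᵢ` is
algebraic over `F(b)`. -/
theorem claim_generic_hyperplane {K : Type*} [Field K] [IsAlgClosed K] [CharZero K]
    (F : Subfield K) (n : ℕ) (hn : 1 ≤ n) (a : Fin n → Kˣ) (c : Fin n → K)
    (hsum : ∑ i, c i * ((a i : Kˣ) : K) = 1)
    (hcind : AlgebraicIndependent F c)
    (hctd : trdegOver (F.adjoinSet (Set.range fun i => ((a i : Kˣ) : K))) (Set.range c)
      = ((n - 1 : ℕ) : Cardinal)) :
    ∀ (m : ℕ) (b : Fin m → K),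
      (∀ j, IsAlgebraic (F.adjoinSet (Set.range fun i => ((a i : Kˣ) : K))) (b j)) →
      trdegOver (F.adjoinSet (Set.range c)) (Set.range b) < trdegOver F (Set.range b) →
      ∀ i, IsAlgebraic (F.adjoinSet (Set.range b)) ((a i : Kˣ) : K) := by
  intro m b hb hlt i
  set A := F.adjoinSet (Set.range fun i => ((a i : Kˣ) : K)) with hA
  obtain ⟨j, hj⟩ := exists_index A n hn c hcind.injective hctd
  have hnot := not_ind_of_lt F c _ hlt
  have hsub : ∀ x ∈ F.adjoinSet (Set.range b), x ∈ algebraicClosure A K := by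
    have : F.adjoinSet (Set.range b) ≤ (algebraicClosure A K).toSubfield := by
      refine Subfield.closure_le.2 ?_
      rintro x (hx | ⟨k, rfl⟩)
      · exact (algebraicClosure A K).algebraMap_mem ⟨x, Subfield.subset_closure (Or.inl hx)⟩
      · exact mem_algebraicClosure_iff.2 (hb k)
    exact this
  let φ : F.adjoinSet (Set.range b) →+* algebraicClosure A K :=
    { toFun := fun x => ⟨x.1, hsub x.1 x.2⟩
      map_one' := rfl
      map_mul' := fun _ _ => rfl
      map_zero' := rfl
      map_add' := fun _ _ => rfl }
  let _ : Algebra (F.adjoinSet (Set.range b)) (algebraicClosure A K) := φ.toAlgebra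
  have : IsScalarTower (F.adjoinSet (Set.range b)) (algebraicClosure A K) K :=
    IsScalarTower.of_algebraMap_eq fun _ => rfl
  have ha : ∀ k, ((a k : Kˣ) : K) ∈ algebraicClosure A K := fun k =>
    (algebraicClosure A K).algebraMap_mem ⟨_, Subfield.subset_closure (Or.inr ⟨k, rfl⟩)⟩
  have := core (L := F.adjoinSet (Set.range b)) (M := algebraicClosure A K)
    (fun k => ⟨_, ha k⟩) c hsum j (fun h => (a j).ne_zero (congrArg Subtype.val h))
    hj.algebraicClosure hnot i
  exact this.algebraMap (A := K)

end
end

section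
/- Let K be an algebraically closed field of characteristic zero, F a subfield of K, n ≥ 1, a ∈ (K^×)^n and c ∈ K^n such that ∑_{i=1}^n c_i·a_i = 1, trdeg(c/F) = n, trdeg(c/F(a)) = n − 1, and 2·trdeg(a/F(c)) ≥ n. Assume that for every k×n integer matrix M of rank k (1 ≤ k ≤ n), 2·trdeg(a^M/F) ≥ k. Then for every k×n integer matrix M of rank k (1 ≤ k ≤ n), 2·trdeg(a^M/F(c)) ≥ k. (The intersection of a rotund variety of dimension d with d − 1 ≥ n/2 with a generic hyperplane is rotund.) -/
noncomputable section

namespace RotundAux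
open AlgebraicIndependent

open scoped IntermediateField.algebraAdjoinAdjoin in
lemma mem_cl {K : Type*} [Field K] (F : Subfield K) (s : Set K) (x : K) :
    x ∈ (matroid F K).closure s ↔ IsAlgebraic (F.adjoinSet s) x := by
  have h : (IntermediateField.adjoin F s).toSubfield = F.adjoinSet s := by
    show Subfield.closure _ = Subfield.closure _
    congr 2
    exact Subtype.range_val
  rw [matroid_closure_eq, ← h]
  exact IsFractionRing.isAlgebraic_iff (Algebra.adjoin F s) (IntermediateField.adjoin F s) K

lemma adjoinSet_adjoinSet {K : Type*} [Field K] (F : Subfield K) (u s : Set K) :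
    (F.adjoinSet u).adjoinSet s = F.adjoinSet (u ∪ s) := by
  unfold Subfield.adjoinSet
  rw [Subfield.closure_union, Subfield.closure_eq, ← Subfield.closure_union, Set.union_assoc]

lemma closure_eq {K : Type*} [Field K] (F : Subfield K) (u s : Set K) :
    (matroid (F.adjoinSet u) K).closure s = (matroid F K).closure (u ∪ s) := by
  ext x
  rw [mem_cl, mem_cl, adjoinSet_adjoinSet]

lemma eRk_add {K : Type*} [Field K] (F : Subfield K) (u s : Set K) (hs : s.Finite) :
    (matroid F K).eRk (u ∪ s) =
      (matroid F K).eRk u + (matroid (F.adjoinSet u) K).eRk s := by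
  induction s, hs using Set.Finite.induction_on with
  | empty => simp
  | @insert x s _ _ ih =>
    rw [Set.union_insert]
    by_cases hx : x ∈ (matroid F K).closure (u ∪ s)
    · have hx' := hx
      rw [← closure_eq] at hx'
      rw [← Matroid.eRk_insert_closure_eq, Set.insert_eq_of_mem hx, Matroid.eRk_closure_eq,
        ← Matroid.eRk_insert_closure_eq, Set.insert_eq_of_mem hx', Matroid.eRk_closure_eq, ih]
    · have hx' := hx
      rw [← closure_eq] at hx'
      rw [Matroid.eRk_insert_eq_add_one ⟨Set.mem_univ _, hx⟩,
        Matroid.eRk_insert_eq_add_one ⟨Set.mem_univ _, hx'⟩, ih, add_assoc]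

lemma indep_iff {K : Type*} [Field K] (F : Subfield K) (s : Set K) :
    (matroid F K).Indep s ↔ AlgebraicIndependent F ((↑) : s → K) := matroid_indep_iff

lemma indep_mono {K : Type*} [Field K] {L E : Subfield K} (hLE : L ≤ E) {s : Set K}
    (h : (matroid E K).Indep s) : (matroid L K).Indep s := by
  rw [indep_iff] at h ⊢
  let : Algebra L E := (Subfield.inclusion hLE).toAlgebra
  have : IsScalarTower L E K := .of_algebraMap_eq fun _ => rfl
  exact h.restrictScalars (algebraMap L E).injective

lemma trdegOver_eq {K : Type*} [Field K] (F : Subfield K) (s : Set K) (hs : s.Finite) :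
    ∃ r : ℕ, (matroid F K).eRk s = r ∧ trdegOver F s = r := by
  obtain ⟨B, hB⟩ := (matroid F K).exists_isBasis s
  have hBf : B.Finite := hs.subset hB.subset
  have hr : (matroid F K).eRk s = (B.ncard : ℕ) := by
    rw [← hB.encard_eq_eRk, hBf.cast_ncard_eq]
  refine ⟨B.ncard, hr, le_antisymm ?_ ?_⟩
  · refine ciSup_le' fun t => ?_
    have htf : t.1.Finite := hs.subset t.2.1
    have := Matroid.Indep.encard_le_eRk_of_subset (M := matroid F K) (I := t.1) ((indep_iff _ _).2 t.2.2) t.2.1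
    rw [hr, ← htf.cast_ncard_eq] at this
    rw [← Set.cast_ncard htf]
    exact_mod_cast this
  · rw [Set.cast_ncard hBf]
    exact le_ciSup_of_le Cardinal.bddAbove_of_small ⟨B, hB.subset, (indep_iff _ _).1 hB.indep⟩ le_rfl

open MvPolynomial in
lemma key1 {L E σ : Type*} [Field L] [Field E] [Algebra L E] [Infinite L] [Fintype σ]
    (e0 : E) (e : σ → E) (Q : Polynomial (MvPolynomial σ L)) (hQ : Q ≠ 0)
    (h : Q.eval₂ (MvPolynomial.map (algebraMap L E)) (C e0 + ∑ i, C (e i) * X i) = 0) :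
    IsAlgebraic L e0 ∧ ∀ i, IsAlgebraic L (e i) := by
  classical
  have ev : ∀ l : σ → L, eval l Q.leadingCoeff ≠ 0 →
      IsAlgebraic L (e0 + ∑ i, e i * algebraMap L E (l i)) := by
    intro l hl
    refine ⟨Q.map (eval l), ?_, ?_⟩
    · intro h0
      apply hl
      have := congrArg (fun p => p.coeff Q.natDegree) h0
      simpa [Polynomial.coeff_map] using this
    · have := congrArg (eval (fun i => algebraMap L E (l i))) h
      rw [Polynomial.hom_eval₂] at this
      rw [Polynomial.aeval_def, Polynomial.eval₂_map]
      have hc : (eval (fun i => algebraMap L E (l i))).comp (MvPolynomial.map (algebraMap L E))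
          = (algebraMap L E).comp (eval l) := by
        ext <;> simp
      rw [hc] at this
      simpa using this
  obtain ⟨l, hl⟩ : ∃ l : σ → L, eval l Q.leadingCoeff ≠ 0 := by
    by_contra! hcon
    apply hQ
    rw [← Polynomial.leadingCoeff_eq_zero]
    exact MvPolynomial.funext fun l => by simpa using hcon l
  have h1 : ∀ i, IsAlgebraic L (e i) := by
    intro i
    let P : Polynomial L := aeval (fun j => Polynomial.C (l j) +
      if j = i then Polynomial.X else 0) Q.leadingCoeff
    have hP : ∀ t, P.eval t = eval (fun j => l j + if j = i then t else 0) Q.leadingCoeff := by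
      intro t
      have : (Polynomial.evalRingHom t).comp (aeval (fun j => Polynomial.C (l j) +
        if j = i then Polynomial.X else 0)).toRingHom =
          eval (fun j => l j + if j = i then t else 0) := by
        ext j
        · simp
        · by_cases hj : j = i <;> simp [hj]
      exact congrArg (fun f => f Q.leadingCoeff) this
    have hP0 : Polynomial.X * P ≠ 0 := by
      refine mul_ne_zero Polynomial.X_ne_zero ?_
      intro h0
      apply hl
      have := hP 0
      rw [h0] at this
      simpa using this.symm
    obtain ⟨t, ht⟩ : ∃ t, (Polynomial.X * P).eval t ≠ 0 := by
      by_contra! hcon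
      exact hP0 (Polynomial.funext fun t => by simpa using hcon t)
    rw [Polynomial.eval_mul, Polynomial.eval_X] at ht
    have ht0 := left_ne_zero_of_mul ht
    have ht1 := right_ne_zero_of_mul ht
    rw [hP] at ht1
    have hd := ((ev _ ht1).sub (ev _ hl)).mul (isAlgebraic_algebraMap (R := L) (A := E) t⁻¹)
    suffices hs : e i = ((e0 + ∑ i_1, e i_1 * (algebraMap L E) (l i_1 + if i_1 = i then t else 0) -
        (e0 + ∑ i, e i * (algebraMap L E) (l i))) * (algebraMap L E) t⁻¹) by
      rw [hs]; exact hd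
    have : algebraMap L E t ≠ 0 := by simpa using ht0
    rw [map_inv₀, eq_mul_inv_iff_mul_eq₀ this]
    simp [mul_add, Finset.sum_add_distrib, apply_ite (algebraMap L E)]
  refine ⟨?_, h1⟩
  have hs : IsAlgebraic L (∑ i, e i * algebraMap L E (l i)) := by
    rw [← mem_algebraicClosure_iff]
    exact sum_mem fun i _ => mem_algebraicClosure_iff.2 ((h1 i).mul (isAlgebraic_algebraMap _))
  simpa using (ev l hl).sub hs

open MvPolynomial in
lemma key2 {L E K σ : Type*} [Field L] [Field E] [Field K] [Algebra L E] [Algebra E K]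
    [Algebra L K] [IsScalarTower L E K] [Infinite L] [Fintype σ]
    (e0 : E) (e : σ → E) (x : σ → K) (hx : AlgebraicIndependent E x)
    (h : IsAlgebraic (Algebra.adjoin L (Set.range x))
      (algebraMap E K e0 + ∑ i, algebraMap E K (e i) * x i)) :
    IsAlgebraic L e0 ∧ ∀ i, IsAlgebraic L (e i) := by
  have hx' : AlgebraicIndependent L x :=
    hx.restrictScalars (algebraMap L E).injective
  obtain ⟨Q, hQ, hQ0⟩ := h
  refine key1 e0 e (Q.map (hx'.aevalEquiv.symm : _ →+* _)) ?_ ?_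
  · exact (Polynomial.map_ne_zero_iff hx'.aevalEquiv.symm.injective).2 hQ
  · apply hx
    rw [map_zero, ← hQ0, Polynomial.eval₂_map]
    change (aeval x : MvPolynomial σ E →ₐ[E] K).toRingHom _ = _
    rw [Polynomial.hom_eval₂, Polynomial.aeval_def]
    congr 1
    · ext y
      obtain ⟨p, rfl⟩ := hx'.aevalEquiv.surjective y
      simp [aeval_map_algebraMap]
    · simp

lemma key3 {K : Type*} [Field K] [CharZero K] (L E : Subfield K) (hLE : L ≤ E) (n : ℕ)
    (a : Fin n → Kˣ) (c : Fin n → K) (hsum : ∑ i, c i * ((a i : Kˣ) : K) = 1)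
    (ha : ∀ i, ((a i : Kˣ) : K) ∈ E) (j : Fin n)
    (hx : AlgebraicIndependent E (fun i : {i // i ≠ j} => c i))
    (hj : IsAlgebraic (Algebra.adjoin L (Set.range (fun i : {i // i ≠ j} => c i))) (c j)) :
    ∀ i, IsAlgebraic L ((a i : Kˣ) : K) := by
  let : Algebra L E := (Subfield.inclusion hLE).toAlgebra
  have : IsScalarTower L E K := .of_algebraMap_eq fun _ => rfl
  have : Infinite L := inferInstance
  let A : Fin n → E := fun i => ⟨a i, ha i⟩
  have hAj : ((a j : Kˣ) : K) ≠ 0 := (a j).ne_zero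
  have hk := key2 (L := L) (E := E) (K := K) (A j)⁻¹ (fun i : {i // i ≠ j} => -(A i) / A j)
    (fun i => c i) hx (by
      convert hj using 1
      have h2 : ∑ i : {i // i ≠ j}, c i * ((a i : Kˣ) : K) = 1 - c j * a j := by
        rw [← hsum, Fintype.sum_eq_add_sum_subtype_ne _ j]; ring
      have h3 : c j = (a j : K)⁻¹ * (1 - ∑ i : {i // i ≠ j}, c i * ((a i : Kˣ) : K)) := by
        rw [h2]; field_simp; ring
      rw [h3, mul_sub, mul_one, Finset.mul_sum, sub_eq_add_neg, ← Finset.sum_neg_distrib]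
      congr 1
      refine Finset.sum_congr rfl fun i _ => ?_
      change (-(a i : K) / (a j : K)) * c i = _
      field_simp)
  have hjj : IsAlgebraic L (A j) := by simpa using hk.1.inv
  intro i
  suffices h : IsAlgebraic L (A i) from h.algebraMap
  by_cases hij : i = j
  · rw [hij]; exact hjj
  · have h := ((hk.2 ⟨i, hij⟩).mul hjj).neg
    have hA : A j ≠ 0 := fun h => hAj (congrArg Subtype.val h)
    simpa [hA] using h

lemma main {K : Type*} [Field K] [CharZero K]
    (F : Subfield K) (n : ℕ) (hn : 1 ≤ n) (a : Fin n → Kˣ) (c : Fin n → K)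
    (hsum : ∑ i, c i * ((a i : Kˣ) : K) = 1)
    (hc : trdegOver F (Set.range c) = (n : Cardinal))
    (hca : trdegOver (F.adjoinSet (Set.range fun i => ((a i : Kˣ) : K))) (Set.range c)
      = ((n - 1 : ℕ) : Cardinal))
    (hac : (n : Cardinal) ≤
      2 * trdegOver (F.adjoinSet (Set.range c)) (Set.range fun i => ((a i : Kˣ) : K)))
    (k : ℕ) (hkn : k ≤ n) (B : Set K) (hBf : B.Finite)
    (hB : B ⊆ F.adjoinSet (Set.range fun i => ((a i : Kˣ) : K)))
    (hk : (k : Cardinal) ≤ 2 * trdegOver F B) :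
    (k : Cardinal) ≤ 2 * trdegOver (F.adjoinSet (Set.range c)) B := by
  set A : Set K := Set.range fun i => ((a i : Kˣ) : K) with hA
  have hAf : A.Finite := Set.finite_range _
  set C : Set K := Set.range c with hC
  have hCf : C.Finite := Set.finite_range _
  obtain ⟨r1, hr1, ht1⟩ := trdegOver_eq F C hCf
  obtain ⟨r2, hr2, ht2⟩ := trdegOver_eq (F.adjoinSet A) C hCf
  obtain ⟨r3, hr3, ht3⟩ := trdegOver_eq (F.adjoinSet C) A hAf
  obtain ⟨r4, hr4, ht4⟩ := trdegOver_eq F B hBf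
  obtain ⟨r5, hr5, ht5⟩ := trdegOver_eq (F.adjoinSet C) B hBf
  obtain ⟨r6, hr6, ht6⟩ := trdegOver_eq (F.adjoinSet B) C hCf
  obtain ⟨r7, hr7, ht7⟩ := trdegOver_eq F A hAf
  rw [ht1] at hc
  rw [ht2] at hca
  rw [ht3] at hac
  rw [ht4] at hk
  rw [ht5]
  have hc' : r1 = n := by exact_mod_cast hc
  have hca' : r2 = n - 1 := by exact_mod_cast hca
  have hac' : n ≤ 2 * r3 := by exact_mod_cast hac
  have hk' : k ≤ 2 * r4 := by exact_mod_cast hk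
  have e1 := eRk_add F A C hCf
  rw [Set.union_comm, eRk_add F C A hAf, hr1, hr2, hr3, hr7] at e1
  have e2 := eRk_add F B C hCf
  rw [Set.union_comm, eRk_add F C B hBf, hr1, hr4, hr5, hr6] at e2
  have e1' : r1 + r3 = r7 + r2 := by exact_mod_cast e1
  have e2' : r1 + r5 = r4 + r6 := by exact_mod_cast e2
  suffices h : k ≤ 2 * r5 by exact_mod_cast h
  have hLE : F.adjoinSet B ≤ F.adjoinSet A := by
    refine Subfield.closure_le.2 (Set.union_subset ?_ hB)
    exact fun x hx => Subfield.subset_closure (Or.inl hx)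
  have hCn : C.encard ≤ n := by
    rw [hC, ← Set.image_univ]
    refine (Set.encard_image_le _ _).trans ?_
    simp
  have hCn' : C.encard = n := by
    refine le_antisymm hCn ?_
    rw [← hc', ← hr1]
    exact Matroid.eRk_le_encard _ _
  have hcinj : Function.Injective c := by
    have h := hCn'
    rw [hC, ← Set.image_univ] at h
    have h2 : (c '' Set.univ).encard = (Set.univ : Set (Fin n)).encard := by rw [h]; simp
    exact Set.injOn_univ.1 (Set.finite_univ.injOn_of_encard_image_eq h2)
  -- a basis of `C` over `F(A)`
  obtain ⟨J, hJ⟩ := (matroid (F.adjoinSet A) K).exists_isBasis C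
  have hJf : J.Finite := hCf.subset hJ.subset
  have hJc : J.encard = ((n - 1 : ℕ) : ℕ∞) := by rw [hJ.encard_eq_eRk, hr2, hca']
  have hJA : AlgebraicIndependent (F.adjoinSet A) ((↑) : J → K) := (indep_iff _ _).1 hJ.indep
  have hJB : (matroid (F.adjoinSet B) K).Indep J := indep_mono hLE hJ.indep
  have hr6l : n - 1 ≤ r6 := by
    have := Matroid.Indep.encard_le_eRk_of_subset (M := matroid (F.adjoinSet B) K) (I := J)
      hJB hJ.subset
    rw [hJc, hr6] at this
    exact_mod_cast this
  by_cases hcase : n ≤ r6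
  · omega
  have hr6e : r6 = n - 1 := by omega
  -- the missing index
  obtain ⟨y, hyC, hyJ⟩ : ∃ y ∈ C, y ∉ J := by
    by_contra! hcon
    have : J = C := hJ.subset.antisymm hcon
    rw [this, hCn'] at hJc
    have : n = n - 1 := by exact_mod_cast hJc
    omega
  obtain ⟨j, rfl⟩ := hyC
  have hJeq : J = Set.range (fun i : {i // i ≠ j} => c i) := by
    have hsub : J ⊆ Set.range (fun i : {i // i ≠ j} => c i) := by
      intro z hz
      obtain ⟨i, rfl⟩ := hJ.subset hz
      refine ⟨⟨i, ?_⟩, rfl⟩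
      rintro rfl
      exact hyJ hz
    refine Set.Finite.eq_of_subset_of_encard_le hJf hsub ?_
    rw [hJc, ← Set.image_univ]
    refine (Set.encard_image_le _ _).trans ?_
    simp [ENat.card_eq_coe_fintype_card]
  have hJbasis : (matroid (F.adjoinSet B) K).IsBasis J C := by
    refine Matroid.Indep.isBasis_of_eRk_ge hJB hJf hJ.subset ?_
    rw [hr6, hr6e, ← hJc]
    exact (Matroid.Indep.eRk_eq_encard hJB).ge
  have hJx : AlgebraicIndependent (F.adjoinSet A) (fun i : {i // i ≠ j} => c i) := by
    refine hJA.comp (fun i : {i // i ≠ j} => (⟨c i, by rw [hJeq]; exact ⟨i, rfl⟩⟩ : J)) ?_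
    intro i i' h
    exact Subtype.ext (hcinj (congrArg Subtype.val h))
  have hjalg : IsAlgebraic
      (Algebra.adjoin (F.adjoinSet B) (Set.range (fun i : {i // i ≠ j} => c i))) (c j) := by
    rw [← hJeq]
    exact (matroid_isBasis_iff.1 hJbasis).2.2 _ ⟨j, rfl⟩
  have halg := key3 (F.adjoinSet B) (F.adjoinSet A) hLE n a c hsum
    (fun i => Subfield.subset_closure (Or.inr ⟨i, rfl⟩)) j hJx hjalg
  have hAB : A ⊆ (matroid F K).closure B := by
    rintro _ ⟨i, rfl⟩
    exact (mem_cl F B _).2 (halg i)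
  have h74 : r7 ≤ r4 := by
    have := (matroid F K).eRk_mono hAB
    rw [Matroid.eRk_closure_eq, hr7, hr4] at this
    exact_mod_cast this
  omega

end RotundAux


/-- The intersection of a rotund variety of dimension `d` with `d − 1 ≥ n/2` with a generic
hyperplane is rotund: if `∑ cᵢ·aᵢ = 1`, `trdeg(c/F) = n`, `trdeg(c/F(a)) = n − 1`,
`2·trdeg(a/F(c)) ≥ n`, and for every `k×n` integer matrix `M` of rank `k` one has
`2·trdeg(a^M/F) ≥ k`, then for every such `M` one has `2·trdeg(a^M/F(c)) ≥ k`. -/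
theorem rotund_inter_generic_hyperplane {K : Type*} [Field K] [IsAlgClosed K] [CharZero K]
    (F : Subfield K) (n : ℕ) (hn : 1 ≤ n) (a : Fin n → Kˣ) (c : Fin n → K)
    (hsum : ∑ i, c i * ((a i : Kˣ) : K) = 1)
    (hc : trdegOver F (Set.range c) = (n : Cardinal))
    (hca : trdegOver (F.adjoinSet (Set.range fun i => ((a i : Kˣ) : K))) (Set.range c)
      = ((n - 1 : ℕ) : Cardinal))
    (hac : (n : Cardinal) ≤
      2 * trdegOver (F.adjoinSet (Set.range c)) (Set.range fun i => ((a i : Kˣ) : K)))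
    (hrot : ∀ k : ℕ, 1 ≤ k → k ≤ n → ∀ M : Matrix (Fin k) (Fin n) ℤ, M.rank = k →
      (k : Cardinal) ≤
        2 * trdegOver F (Set.range fun j => ((∏ i, a i ^ M j i : Kˣ) : K))) :
    ∀ k : ℕ, 1 ≤ k → k ≤ n → ∀ M : Matrix (Fin k) (Fin n) ℤ, M.rank = k →
      (k : Cardinal) ≤
        2 * trdegOver (F.adjoinSet (Set.range c))
          (Set.range fun j => ((∏ i, a i ^ M j i : Kˣ) : K)) := by
  intro k hk hkn M hM
  refine RotundAux.main F n hn a c hsum hc hca hac k hkn _ (Set.finite_range _) ?_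
    (hrot k hk hkn M hM)
  rintro _ ⟨j, rfl⟩
  simp only [Units.coe_prod, Units.val_zpow_eq_zpow_val]
  refine prod_mem fun i _ => ?_
  have hi : ((a i : Kˣ) : K) ∈ F.adjoinSet (Set.range fun i => ((a i : Kˣ) : K)) :=
    Subfield.subset_closure (Or.inr ⟨i, rfl⟩)
  exact zpow_mem hi _


end
end

section
/- Let K be an algebraically closed field of characteristic zero, F a subfield of K, and let n, k be positive integers with 2k ≤ n. Let c¹, …, c^k ∈ K^n be tuples whose kn coordinates are algebraically independent over F, and let b ∈ (K^×)^n satisfy ∑_{i=1}^n c^j_i·b_i = 1 for each j = 1, …, k and trdeg(b/F(c¹, …, c^k)) = n − k. Then for every r×n integer matrix M of rank r (1 ≤ r ≤ n), 2·trdeg(b^M/F(c¹, …, c^k)) ≥ r. (The intersection of k ≤ n/2 generic hyperplanes in (K^×)^n is rotund.) -/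
noncomputable section

theorem rows_li {F : Type*} [Field F] [CharZero F] {r n : ℕ} (M : Matrix (Fin r) (Fin n) ℤ)
    (hM : M.rank = r) : LinearIndependent F (fun l : Fin r => fun i : Fin n => (M l i : F)) := by
  have h1 : r ≤ Module.finrank ℤ (LinearMap.range M.mulVecLin) := by
    have : M.rank = Module.finrank ℤ (LinearMap.range M.mulVecLin) := rfl
    omega
  obtain ⟨f, hf⟩ := exists_linearIndependent_of_le_finrank h1
  have hf' : LinearIndependent ℤ (fun l => (f l : Fin r → ℤ)) :=
    hf.map' (LinearMap.range M.mulVecLin).subtype (Submodule.ker_subtype _)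
  choose U hU using fun l => (f l).2
  let W : Matrix (Fin r) (Fin r) ℤ := Matrix.of fun l => (f l : Fin r → ℤ)
  have hW : W.det ≠ 0 := by
    intro h0
    obtain ⟨v, hv, hv0⟩ := Matrix.exists_vecMul_eq_zero_iff.mpr h0
    apply hv
    rw [Fintype.linearIndependent_iff] at hf'
    funext i
    apply hf' v _ i
    rw [Matrix.vecMul_eq_sum] at hv0
    exact hv0
  have hWM : W = (Matrix.of U) * M.transpose := by
    ext l j
    have := congrFun (hU l) j
    simp only [W, Matrix.of_apply, ← this, Matrix.mulVecLin_apply, Matrix.mulVec, dotProduct,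
      Matrix.mul_apply, Matrix.transpose_apply]
    exact Finset.sum_congr rfl fun _ _ => mul_comm _ _
  have hWF : (W.map (Int.castRingHom F)).det ≠ 0 := by
    have := RingHom.map_det (Int.castRingHom F) W
    rw [RingHom.mapMatrix_apply] at this
    rw [← this]
    simpa using hW
  rw [Fintype.linearIndependent_iff]
  intro g hg
  have : (W.map (Int.castRingHom F)).mulVec g = 0 := by
    rw [hWM, Matrix.map_mul, ← Matrix.mulVec_mulVec]
    have : (M.transpose.map (Int.castRingHom F)).mulVec g = 0 := by
      rw [← hg]
      ext i
      simp [Matrix.mulVec, dotProduct, mul_comm]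
    rw [this, Matrix.mulVec_zero]
  exact congrFun (Matrix.eq_zero_of_mulVec_eq_zero hWF this)

theorem extend_rows {F V : Type*} [Field F] [AddCommGroup V] [Module F V] [FiniteDimensional F V]
    (s : V →ₗ[F] F) (y : V) (hy : s y = 1) {m : ℕ} (u : Fin m → V) (hu : LinearIndependent F u)
    (p : ℕ) (hmp : m ≤ p) : p ≤ Module.finrank F V → 
    ∃ P : Fin p → V, LinearIndependent F P ∧ (∀ (l : Fin p) (h : l.1 < m), P l = u ⟨l, h⟩) ∧
      ∀ l : Fin p, m ≤ l.1 → s (P l) = 1 := by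
  induction p, hmp using Nat.le_induction with
  | base => 
    intro _
    exact ⟨u, hu, fun _ _ => rfl, fun l h => absurd l.2 (by omega)⟩
  | succ p hmp ih =>
    intro hp
    obtain ⟨P, hP, h1, h2⟩ := ih (by omega)
    obtain ⟨x, hx⟩ : ∃ x, x ∉ Submodule.span F (Set.range P) ∧ s x = 1 := by
      obtain ⟨x, hx⟩ := exists_linearIndependent_snoc_of_lt_finrank hP (by omega)
      have hx := (linearIndependent_finSnoc.mp hx).2
      by_cases hyP : y ∈ Submodule.span F (Set.range P)
      · refine ⟨x + (1 - s x) • y, fun h => hx ?_, by simp [hy]⟩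
        have := Submodule.sub_mem _ h (Submodule.smul_mem _ (1 - s x) hyP)
        simpa using this
      · exact ⟨y, hyP, hy⟩
    refine ⟨Fin.snoc P x, linearIndependent_finSnoc.mpr ⟨hP, hx.1⟩, ?_, ?_⟩
    · intro l
      refine Fin.lastCases ?_ (fun l => ?_) l
      · intro h; simp at h; omega
      · intro h; simpa using h1 l h
    · intro l
      refine Fin.lastCases ?_ (fun l => ?_) l
      · intro h; simpa using hx.2
      · intro h; simpa using h2 l h

theorem alg_of_rows {E L : Type*} [Field E] [Field L] [Algebra E L] {n : ℕ}
    (b : Fin n → L) (hb0 : ∀ i, b i ≠ 0)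
    (htop : IntermediateField.adjoin E (Set.range b) = ⊤)
    (Q : Matrix (Fin n) (Fin n) L) (hQ : Q.det ≠ 0)
    (hrow : ∀ l, (∃ z : Fin n → ℤ, (∀ i, Q l i = z i) ∧
        ∃ x : E, ∏ i, b i ^ z i = algebraMap E L x) ∨
      (∃ w : Fin n → E, (∀ i, Q l i = algebraMap E L (w i) * b i) ∧
        ∃ x : E, ∑ i, algebraMap E L (w i) * b i = algebraMap E L x)) :
    Algebra.IsAlgebraic E L := by
  let D := KaehlerDifferential.D E L
  have hprod : ∀ (z : Fin n → ℤ) (s : Finset (Fin n)), 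
      D (∏ i ∈ s, b i ^ z i) = (∏ i ∈ s, b i ^ z i) • ∑ i ∈ s, ((z i : L) * (b i)⁻¹) • D (b i) := by
    intro z s
    induction s using Finset.induction_on with
    | empty => simp
    | insert a s ha ih =>
      rw [Finset.prod_insert ha, Finset.sum_insert ha, Derivation.leibniz, ih,
        Derivation.leibniz_zpow, ← Int.cast_smul_eq_zsmul L, zpow_sub₀ (hb0 a)]
      simp only [smul_add, smul_smul, zpow_one]
      rw [add_comm]
      congr 2
      ring
  have key : ∀ l, ∑ i, Q l i • ((b i)⁻¹ • D (b i)) = 0 := by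
    intro l
    rcases hrow l with ⟨z, hz, x, hx⟩ | ⟨w, hw, x, hx⟩
    · have h := hprod z Finset.univ
      have hD : D (∏ i, b i ^ z i) = 0 := by rw [hx]; exact Derivation.map_algebraMap _ _
      rw [hD] at h
      have hne : (∏ i, b i ^ z i) ≠ 0 := Finset.prod_ne_zero_iff.mpr fun i _ => zpow_ne_zero _ (hb0 i)
      have := (smul_eq_zero.mp h.symm).resolve_left hne
      simpa [hz, smul_smul] using this
    · have hD : D (∑ i, algebraMap E L (w i) * b i) = 0 := by
        rw [hx]; exact Derivation.map_algebraMap _ _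
      rw [map_sum] at hD
      rw [← hD]
      refine Finset.sum_congr rfl fun i _ => ?_
      rw [hw, smul_smul, mul_assoc, mul_inv_cancel₀ (hb0 i), mul_one, Derivation.leibniz,
        Derivation.map_algebraMap, smul_zero, add_zero]
  have hDb : ∀ i, D (b i) = 0 := by
    intro i
    have h1 : ∑ i', (∑ l, Q⁻¹ i l * Q l i') • ((b i')⁻¹ • D (b i')) = 0 := by
      simp_rw [Finset.sum_smul]
      rw [Finset.sum_comm]
      refine Finset.sum_eq_zero fun l _ => ?_
      have := congrArg (fun t => Q⁻¹ i l • t) (key l)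
      simpa [Finset.smul_sum, smul_smul, mul_assoc] using this
    have h2 : Q⁻¹ * Q = 1 := Matrix.nonsing_inv_mul _ (isUnit_iff_ne_zero.mpr hQ)
    simp_rw [← Matrix.mul_apply, h2, Matrix.one_apply] at h1
    simpa [hb0 i] using h1
  have hDall : ∀ x, D x = 0 := by
    intro x
    have hx : x ∈ IntermediateField.adjoin E (Set.range b) := by rw [htop]; trivial
    induction hx using IntermediateField.adjoin_induction with
    | mem x hx => obtain ⟨i, rfl⟩ := hx; exact hDb i
    | algebraMap x => exact Derivation.map_algebraMap _ _
    | add x y _ _ hx hy => simp [hx, hy]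
    | inv x _ hx => simp [Derivation.leibniz_inv, hx]
    | mul x y _ _ hx hy => simp [hx, hy]
  have hsub : Subsingleton (Ω[L⁄E]) := by
    rw [← Submodule.subsingleton_iff L, ← subsingleton_iff_bot_eq_top, 
      ← KaehlerDifferential.span_range_derivation, eq_comm, Submodule.span_eq_bot]
    rintro _ ⟨x, rfl⟩
    exact hDall x
  have : Algebra.FormallyUnramified E L := ⟨hsub⟩
  have : Algebra.EssFiniteType E L := by
    have h : (⊤ : IntermediateField E L).FG := by
      rw [← htop]
      exact IntermediateField.fg_adjoin_of_finite (Set.finite_range b)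
    rw [← IntermediateField.essFiniteType_iff] at h
    exact (Algebra.EssFiniteType.iff_of_algEquiv IntermediateField.topEquiv).mp h
  have := Algebra.FormallyUnramified.isSeparable E L
  infer_instance

theorem le_eRk_of_le_trdegOver {K : Type*} [Field K] (G : Subfield K) (s : Set K) (p : ℕ)
    (h : (p : Cardinal) ≤ trdegOver G s) :
    (p : ℕ∞) ≤ (AlgebraicIndependent.matroid G K).eRk s := by
  by_contra! hlt
  obtain ⟨q, hq⟩ := ENat.ne_top_iff_exists.mp hlt.ne_top
  rw [← hq] at hlt
  have hqp : q < p := by exact_mod_cast hlt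
  have h2 : trdegOver G s ≤ (q : Cardinal) := by
    refine ciSup_le' ?_
    rintro ⟨t, hts, ht⟩
    have h3 : t.encard ≤ q := by
      rw [hq]
      exact Matroid.Indep.encard_le_eRk_of_subset
        (AlgebraicIndependent.matroid_indep_iff.mpr ht) hts
    have hfin : t.Finite := Set.finite_of_encard_le_coe h3
    rw [hfin.encard_eq_coe_toFinset_card] at h3
    have h4 : hfin.toFinset.card ≤ q := by exact_mod_cast h3
    have h5 : Cardinal.mk t = (hfin.toFinset.card : Cardinal) := by
      rw [← Cardinal.mk_coe_finset]
      simp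
    rw [h5]
    exact_mod_cast h4
  have : (p : Cardinal) ≤ q := h.trans h2
  have : p ≤ q := by exact_mod_cast this
  omega

theorem le_trdegOver_of_le_eRk {K : Type*} [Field K] (G : Subfield K) (s : Set K) (p : ℕ)
    (h : (p : ℕ∞) ≤ (AlgebraicIndependent.matroid G K).eRk s) :
    (p : Cardinal) ≤ trdegOver G s := by
  obtain ⟨I, hIs, hI, hc⟩ := Matroid.le_eRk_iff.mp h
  have hfin : I.Finite := Set.finite_of_encard_eq_coe hc
  have h5 : Cardinal.mk I = (p : Cardinal) := by
    rw [hfin.encard_eq_coe_toFinset_card] at hc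
    have hc : hfin.toFinset.card = p := by exact_mod_cast hc
    rw [← hc, ← Cardinal.mk_coe_finset]
    simp
  rw [← h5]
  exact le_ciSup (f := fun t : {t : Set K // t ⊆ s ∧ AlgebraicIndependent G ((↑) : t → K)} =>
    Cardinal.mk t.1) Cardinal.bddAbove_of_small
    ⟨I, hIs, AlgebraicIndependent.matroid_indep_iff.mp hI⟩

open scoped IntermediateField.algebraAdjoinAdjoin in
theorem mem_closure_of_alg {F K : Type*} [Field F] [Field K] [Algebra F K] (S : Set K) (x : K)
    (h : IsAlgebraic (IntermediateField.adjoin F S) x) :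
    x ∈ (AlgebraicIndependent.matroid F K).closure S := by
  rw [AlgebraicIndependent.matroid_closure_eq]
  change IsAlgebraic (Algebra.adjoin F S) x
  exact (IsFractionRing.isAlgebraic_iff (Algebra.adjoin F S) (IntermediateField.adjoin F S) K).mpr h

theorem y_indep {K : Type*} [Field K] (F : Subfield K) (n' k : ℕ) (hkn : k ≤ n' + 1)
    (c : Fin k → Fin (n' + 1) → K)
    (hcind : AlgebraicIndependent F (fun p : Fin k × Fin (n' + 1) => c p.1 p.2))
    (b : Fin (n' + 1) → K) (hb0 : b 0 ≠ 0)
    (hsum : ∀ j, ∑ i, c j i * b i = 1)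
    (hb : ((n' + 1 - k : ℕ) : Cardinal) ≤
      trdegOver (F.adjoinSet (Set.range fun p : Fin k × Fin (n' + 1) => c p.1 p.2)) (Set.range b)) :
    AlgebraicIndependent F (Sum.elim (fun p : Fin k × Fin n' => c p.1 p.2.succ) b) := by
  set y := Sum.elim (fun p : Fin k × Fin n' => c p.1 p.2.succ) b with hy
  set L := F.adjoinSet (Set.range fun p : Fin k × Fin (n' + 1) => c p.1 p.2) with hL
  have hFL : F ≤ L := fun x hx => Subfield.subset_closure (Or.inl hx)
  let MF := AlgebraicIndependent.matroid F K
  obtain ⟨I, hIb, hI, hIc⟩ := Matroid.le_eRk_iff.mp (le_eRk_of_le_trdegOver _ _ _ hb)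
  have hI := AlgebraicIndependent.matroid_indep_iff.mp hI
  let _ : Algebra F L := (Subfield.inclusion hFL).toAlgebra
  have : IsScalarTower F L K := IsScalarTower.of_algebraMap_eq fun _ => rfl
  have hun : AlgebraicIndependent F (Sum.elim ((↑) : I → K)
      (fun p : Fin k × Fin (n' + 1) => c p.1 p.2)) := by
    refine hcind.sumElim_of_tower (S := L) ?_ hI
    rintro _ ⟨p, rfl⟩
    exact ⟨⟨_, Subfield.subset_closure (Or.inr ⟨p, rfl⟩)⟩, rfl⟩
  have hinj := hun.injective
  have hindU := (algebraicIndependent_subtype_range hinj).mpr hun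
  have hcardU : (Set.range (Sum.elim ((↑) : I → K)
      (fun p : Fin k × Fin (n' + 1) => c p.1 p.2))).encard = ((k * n' + (n' + 1) : ℕ) : ℕ∞) := by
    rw [← Set.image_univ, hinj.encard_image, Set.encard_univ, ENat.card_sum]
    have : ENat.card I = ((n' + 1 - k : ℕ) : ℕ∞) := hIc
    rw [this]
    simp only [ENat.card_eq_coe_fintype_card, Fintype.card_prod, Fintype.card_fin]
    norm_cast
    rw [mul_add]
    omega
  have hymem : ∀ i, y i ∈ IntermediateField.adjoin F (Set.range y) := fun i =>
    IntermediateField.subset_adjoin _ _ ⟨i, rfl⟩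
  have hsub : Set.range (Sum.elim ((↑) : I → K)
      (fun p : Fin k × Fin (n' + 1) => c p.1 p.2)) ⊆ MF.closure (Set.range y) := by
    rintro _ ⟨i, rfl⟩
    apply mem_closure_of_alg
    have : ∀ x : K, x ∈ IntermediateField.adjoin F (Set.range y) →
      IsAlgebraic (IntermediateField.adjoin F (Set.range y)) x := fun x hx =>
      isAlgebraic_algebraMap (⟨x, hx⟩ : IntermediateField.adjoin F (Set.range y))
    apply this
    rcases i with ⟨x, hx⟩ | ⟨j, i⟩
    · obtain ⟨i, rfl⟩ := hIb hx
      exact hymem (Sum.inr i)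
    · simp only [Sum.elim_inr]
      refine Fin.cases ?_ (fun i => hymem (Sum.inl (j, i))) i
      have h := hsum j
      rw [Fin.sum_univ_succ] at h
      have h' : c j 0 = (1 - ∑ i : Fin n', c j i.succ * b i.succ) / b 0 := by
        rw [eq_div_iff hb0, ← h]; ring
      rw [h']
      refine div_mem (sub_mem (one_mem _) (sum_mem fun i _ => mul_mem ?_ ?_)) (hymem (Sum.inr 0))
      · exact hymem (Sum.inl (j, i))
      · exact hymem (Sum.inr _)
  have h1 : ((k * n' + (n' + 1) : ℕ) : ℕ∞) ≤ MF.eRk (Set.range y) := by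
    rw [← Matroid.eRk_closure_eq, ← hcardU]
    exact Matroid.Indep.encard_le_eRk_of_subset
      (AlgebraicIndependent.matroid_indep_iff.mpr hindU) hsub
  have hcardσ : ENat.card ((Fin k × Fin n') ⊕ Fin (n' + 1)) = ((k * n' + (n' + 1) : ℕ) : ℕ∞) := by
    simp only [ENat.card_eq_coe_fintype_card, Fintype.card_prod, Fintype.card_fin,
      Fintype.card_sum]
  have h2 : (Set.range y).encard ≤ ((k * n' + (n' + 1) : ℕ) : ℕ∞) := by
    rw [← Set.image_univ, ← hcardσ, ← Set.encard_univ]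
    exact Set.encard_image_le _ _
  have hfin : (Set.range y).Finite := Set.finite_range y
  have hindy : MF.Indep (Set.range y) := by
    rw [Matroid.indep_iff_eRk_eq_encard_of_finite hfin]
    exact le_antisymm (Matroid.eRk_le_encard _ _) (h2.trans h1)
  have hyinj : Function.Injective y := by
    have h3 : (y '' Set.univ).encard = (Set.univ : Set ((Fin k × Fin n') ⊕ Fin (n' + 1))).encard := by
      rw [Set.image_univ, Set.encard_univ, hcardσ]
      exact le_antisymm h2 (h1.trans (Matroid.eRk_le_encard _ _))
    exact Set.injOn_univ.mp (Set.finite_univ.injOn_of_encard_image_eq h3)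
  exact (algebraicIndependent_subtype_range hyinj).mp
    (AlgebraicIndependent.matroid_indep_iff.mp hindy)

theorem det_ne {K : Type*} [Field K] (F : Subfield K) (n' k : ℕ)
    (c : Fin k → Fin (n' + 1) → K) (b : Fin (n' + 1) → K)
    (hsum : ∀ j, ∑ i, c j i * b i = 1)
    (hy : AlgebraicIndependent F (Sum.elim (fun p : Fin k × Fin n' => c p.1 p.2.succ) b))
    (P : Matrix (Fin (n' + 1)) (Fin (n' + 1)) F) (hP : P.det ≠ 0)
    (q : Fin k → Fin (n' + 1)) (hq : ∀ j, ∑ i, P (q j) i = 1)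
    (Q : Matrix (Fin (n' + 1)) (Fin (n' + 1)) K)
    (hQ : ∀ l, (∀ i, Q l i = P l i) ∨ (∀ i, Q l i = P l i * b i) ∨
      ∃ j, l = q j ∧ ∀ i, Q l i = c j i * b i) : Q.det ≠ 0 := by
  set y := Sum.elim (fun p : Fin k × Fin n' => c p.1 p.2.succ) b with hydef
  let z : (Fin k × Fin n') ⊕ Fin (n' + 1) → F := Sum.elim (fun p => P (q p.1) p.2.succ) (fun _ => 1)
  have hrow : ∀ l, ∃ g : Fin (n' + 1) → MvPolynomial ((Fin k × Fin n') ⊕ Fin (n' + 1)) F,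
      (∀ i, MvPolynomial.aeval y (g i) = Q l i) ∧ ∀ i, MvPolynomial.eval z (g i) = P l i := by
    intro l
    rcases hQ l with h | h | ⟨j, rfl, h⟩
    · refine ⟨fun i => MvPolynomial.C (P l i), fun i => ?_, fun i => by simp⟩
      rw [h, MvPolynomial.aeval_C]; rfl
    · refine ⟨fun i => MvPolynomial.C (P l i) * MvPolynomial.X (Sum.inr i), fun i => ?_,
        fun i => by simp [z]⟩
      rw [h, map_mul, MvPolynomial.aeval_C, MvPolynomial.aeval_X]; rfl
    · refine ⟨Fin.cons (1 - ∑ i : Fin n', MvPolynomial.X (Sum.inl (j, i)) *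
          MvPolynomial.X (Sum.inr i.succ))
          (fun i => MvPolynomial.X (Sum.inl (j, i)) * MvPolynomial.X (Sum.inr i.succ)), ?_, ?_⟩
      · intro i
        rw [h]
        refine Fin.cases ?_ (fun i => ?_) i
        · have := hsum j
          rw [Fin.sum_univ_succ] at this
          simp only [Fin.cons_zero, map_sub, map_one, map_sum, map_mul, MvPolynomial.aeval_X, y,
            Sum.elim_inl, Sum.elim_inr]
          rw [← this]; ring
        · simp [y]
      · intro i
        refine Fin.cases ?_ (fun i => ?_) i
        · have := hq j
          rw [Fin.sum_univ_succ] at this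
          simp only [Fin.cons_zero, map_sub, map_one, map_sum, map_mul, MvPolynomial.eval_X, z,
            Sum.elim_inl, Sum.elim_inr, mul_one]
          rw [← this]; ring
        · simp [z]
  choose g hg1 hg2 using hrow
  intro h0
  have e1 : MvPolynomial.aeval y (Matrix.det (Matrix.of g)) = Q.det := by
    rw [AlgHom.map_det]
    congr 1
    ext l i
    simp [hg1]
  have e2 : MvPolynomial.eval z (Matrix.det (Matrix.of g)) = P.det := by
    rw [RingHom.map_det]
    congr 1
    ext l i
    simp [hg2]
  have h3 : Matrix.det (Matrix.of g) = 0 := hy.eq_zero_of_aeval_eq_zero _ (by rw [e1, h0])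
  rw [h3, map_zero] at e2
  exact hP e2.symm

/-- The intersection of `k ≤ n/2` generic hyperplanes in `(K^×)^n` is rotund: if the `kn`
coordinates of `c¹, …, c^k ∈ K^n` are algebraically independent over `F`, `b ∈ (K^×)^n`
satisfies `∑ c^j_i·b_i = 1` for each `j` and `trdeg(b/F(c¹,…,c^k)) = n − k`, then for every
`r×n` integer matrix `M` of rank `r` one has `2·trdeg(b^M/F(c¹,…,c^k)) ≥ r`. -/
theorem generic_hyperplanes_rotund {K : Type*} [Field K] [IsAlgClosed K] [CharZero K]
    (F : Subfield K) (n k : ℕ) (hn : 1 ≤ n) (hk : 1 ≤ k) (hkn : 2 * k ≤ n)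
    (c : Fin k → Fin n → K)
    (hcind : AlgebraicIndependent F (fun p : Fin k × Fin n => c p.1 p.2))
    (b : Fin n → Kˣ)
    (hsum : ∀ j, ∑ i, c j i * ((b i : Kˣ) : K) = 1)
    (hb : trdegOver (F.adjoinSet (Set.range fun p : Fin k × Fin n => c p.1 p.2))
        (Set.range fun i => ((b i : Kˣ) : K)) = ((n - k : ℕ) : Cardinal)) :
    ∀ r : ℕ, 1 ≤ r → r ≤ n → ∀ M : Matrix (Fin r) (Fin n) ℤ, M.rank = r →
      (r : Cardinal) ≤
        2 * trdegOver (F.adjoinSet (Set.range fun p : Fin k × Fin n => c p.1 p.2))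
          (Set.range fun j => ((∏ i, b i ^ M j i : Kˣ) : K)) := by
  intro r hr1 hrn M hM
  obtain ⟨n', rfl⟩ : ∃ n', n = n' + 1 := ⟨n - 1, by omega⟩
  set L := F.adjoinSet (Set.range fun p : Fin k × Fin (n' + 1) => c p.1 p.2) with hL
  have hFL : F ≤ L := fun x hx => Subfield.subset_closure (Or.inl hx)
  have hcL : ∀ j i, c j i ∈ L := fun j i => Subfield.subset_closure (Or.inr ⟨(j, i), rfl⟩)
  let bK : Fin (n' + 1) → K := fun i => (b i : K)
  have hbK0 : ∀ i, bK i ≠ 0 := fun i => (b i).ne_zero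
  have hyind := y_indep F n' k (by omega) c hcind bK (hbK0 0) hsum hb.ge
  obtain ⟨m, hmdef⟩ : ∃ m, m = min r (n' + 1 - k) := ⟨_, rfl⟩
  have hmr : m ≤ r := by omega
  let u : Fin m → (Fin (n' + 1) → F) := fun l i => (M (Fin.castLE hmr l) i : F)
  have hu : LinearIndependent F u :=
    (rows_li (F := F) M hM).comp (Fin.castLE hmr) (Fin.castLE_injective hmr)
  let s : (Fin (n' + 1) → F) →ₗ[F] F := ∑ i, LinearMap.proj i
  have hs : ∀ v, s v = ∑ i, v i := by intro v; simp [s]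
  obtain ⟨P, hPli, hP1, hP2⟩ := extend_rows s (Pi.single 0 1) (by rw [hs]; simp) u hu (n' + 1)
    (by omega) (by simp)
  have hPdet : (Matrix.of P).det ≠ 0 := by
    have : IsUnit (Matrix.of P) := Matrix.linearIndependent_rows_iff_isUnit.mp hPli
    rw [Matrix.isUnit_iff_isUnit_det] at this
    exact this.ne_zero
  let q : Fin k → Fin (n' + 1) := fun j => ⟨n' + 1 - k + j, by omega⟩
  let Q : Matrix (Fin (n' + 1)) (Fin (n' + 1)) K := Matrix.of fun l i =>
    if l.1 < m then (P l i : K) else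
    if h : l.1 < n' + 1 - k then (P l i : K) * bK i else c ⟨l.1 - (n' + 1 - k), by omega⟩ i * bK i
  have hQ1 : ∀ l i, l.1 < m → Q l i = P l i := fun l i h => by simp [Q, h]
  have hQ2 : ∀ l i, ¬ l.1 < m → l.1 < n' + 1 - k → Q l i = P l i * bK i :=
    fun l i h h' => by simp [Q, h, h']
  have hQ3 : ∀ (l : Fin (n' + 1)) i (h' : ¬ l.1 < n' + 1 - k),
      Q l i = c ⟨l.1 - (n' + 1 - k), by omega⟩ i * bK i :=
    fun l i h' => by
      have h : ¬ l.1 < m := by omega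
      simp [Q, h, h']
  have hQdet : Q.det ≠ 0 := by
    refine det_ne F n' k c bK hsum hyind (Matrix.of P) hPdet q ?_ Q ?_
    · intro j
      have := hP2 (q j) (by simp only [q]; omega)
      rw [hs] at this
      exact this
    · intro l
      by_cases h : l.1 < m
      · exact Or.inl fun i => hQ1 l i h
      by_cases h' : l.1 < n' + 1 - k
      · exact Or.inr (Or.inl fun i => hQ2 l i h h')
      · refine Or.inr (Or.inr ⟨⟨l.1 - (n' + 1 - k), by omega⟩, ?_, fun i => hQ3 l i h'⟩)
        ext
        simp only [q]
        omega
  set Dset : Set K := Set.range fun j => ((∏ i, b i ^ M j i : Kˣ) : K) with hDset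
  let e : Fin (n' + 1 - k - m) → K := fun l => ∑ i, (P ⟨m + l, by omega⟩ i : K) * bK i
  let S : Set K := Dset ∪ Set.range e
  let E := IntermediateField.adjoin L S
  have hLE : ∀ x : K, x ∈ L → x ∈ E := fun x hx => E.algebraMap_mem ⟨x, hx⟩
  let Lb := IntermediateField.adjoin E (Set.range bK)
  have hELb : ∀ x : K, x ∈ E → x ∈ Lb := fun x hx => Lb.algebraMap_mem ⟨x, hx⟩
  have hbLb : ∀ i, bK i ∈ Lb := fun i => IntermediateField.subset_adjoin _ _ ⟨i, rfl⟩
  let b' : Fin (n' + 1) → Lb := fun i => ⟨bK i, hbLb i⟩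
  have htop : IntermediateField.adjoin E (Set.range b') = ⊤ := by
    apply IntermediateField.map_injective Lb.val
    rw [IntermediateField.adjoin_map, ← Set.range_comp]
    ext x
    rw [IntermediateField.mem_map]
    constructor
    · intro hx
      exact ⟨⟨x, hx⟩, trivial, rfl⟩
    · rintro ⟨x, -, rfl⟩
      exact x.2
  have hQmem : ∀ l i, Q l i ∈ Lb := by
    intro l i
    by_cases h : l.1 < m
    · rw [hQ1 l i h]; exact hELb _ (hLE _ (hFL (P l i).2))
    by_cases h' : l.1 < n' + 1 - k
    · rw [hQ2 l i h h']; exact mul_mem (hELb _ (hLE _ (hFL (P l i).2))) (hbLb i)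
    · rw [hQ3 l i h']; exact mul_mem (hELb _ (hLE _ (hcL _ _))) (hbLb i)
  let Q' : Matrix (Fin (n' + 1)) (Fin (n' + 1)) Lb := Matrix.of fun l i => ⟨Q l i, hQmem l i⟩
  have hQ'det : Q'.det ≠ 0 := by
    intro h0
    apply hQdet
    have := RingHom.map_det (algebraMap Lb K) Q'
    rw [h0, map_zero] at this
    exact this.symm
  have halg : Algebra.IsAlgebraic E Lb := by
    refine alg_of_rows b' (fun i h => hbK0 i (congrArg Subtype.val h)) htop Q' hQ'det ?_
    intro l
    by_cases h : l.1 < m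
    · left
      refine ⟨fun i => M (Fin.castLE hmr ⟨l.1, h⟩) i, fun i => ?_, ?_⟩
      · apply Subtype.ext
        change Q l i = _
        rw [hQ1 l i h, hP1 l h]
        simp [u]
      · refine ⟨⟨((∏ i, b i ^ M (Fin.castLE hmr ⟨l.1, h⟩) i : Kˣ) : K),
          IntermediateField.subset_adjoin _ _ (Or.inl ⟨_, rfl⟩)⟩, ?_⟩
        apply (algebraMap Lb K).injective
        rw [map_prod]
        simp_rw [map_zpow₀]
        change ∏ i, (bK i) ^ _ = ((∏ i, b i ^ M (Fin.castLE hmr ⟨l.1, h⟩) i : Kˣ) : K)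
        simp [bK]
    right
    by_cases h' : l.1 < n' + 1 - k
    · refine ⟨fun i => ⟨P l i, hLE _ (hFL (P l i).2)⟩, fun i => Subtype.ext (hQ2 l i h h'), ?_⟩
      have hl : e ⟨l.1 - m, by omega⟩ = ∑ i, (P l i : K) * bK i := by
        simp only [e]
        have : (⟨m + (l.1 - m), by omega⟩ : Fin (n' + 1)) = l := Fin.ext (by simp; omega)
        rw [this]
      refine ⟨⟨_, IntermediateField.subset_adjoin _ _ (Or.inr ⟨⟨l.1 - m, by omega⟩, rfl⟩)⟩, ?_⟩
      apply (algebraMap Lb K).injective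
      rw [map_sum]
      exact hl.symm
    · refine ⟨fun i => ⟨c ⟨l.1 - (n' + 1 - k), by omega⟩ i, hLE _ (hcL _ _)⟩,
        fun i => Subtype.ext (hQ3 l i h'), 1, ?_⟩
      apply (algebraMap Lb K).injective
      rw [map_sum, map_one, map_one]
      exact hsum _
  have hcl : Set.range bK ⊆ (AlgebraicIndependent.matroid L K).closure S := by
    rintro _ ⟨i, rfl⟩
    apply mem_closure_of_alg
    exact (halg.isAlgebraic (b' i)).algebraMap
  have h1 := le_eRk_of_le_trdegOver L (Set.range bK) _ hb.ge
  have h2 : ((n' + 1 - k : ℕ) : ℕ∞) ≤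
      (AlgebraicIndependent.matroid L K).eRk Dset + ((n' + 1 - k - m : ℕ) : ℕ∞) := by
    refine h1.trans ((Matroid.eRk_mono _ hcl).trans ?_)
    rw [Matroid.eRk_closure_eq]
    refine (Matroid.eRk_union_le_eRk_add_encard _ _ _).trans ?_
    gcongr
    rw [← Set.image_univ]
    refine (Set.encard_image_le _ _).trans ?_
    simp
  have h3 : (m : ℕ∞) ≤ (AlgebraicIndependent.matroid L K).eRk Dset := by
    have h4 : ((n' + 1 - k : ℕ) : ℕ∞) = (m : ℕ∞) + ((n' + 1 - k - m : ℕ) : ℕ∞) := by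
      norm_cast
      omega
    rw [h4] at h2
    exact (ENat.add_le_add_iff_right (ENat.natCast_ne_top _)).mp h2
  have h5 := le_trdegOver_of_le_eRk L Dset m h3
  calc (r : Cardinal) ≤ ((2 * m : ℕ) : Cardinal) := by
        norm_cast
        omega
    _ = 2 * (m : Cardinal) := by push_cast; rfl
    _ ≤ _ := by gcongr

end
end

section
/- Let K be an algebraically closed field of characteristic zero and let G be a divisible subgroup of K^×. Let X ⊆ Y be finite-rank root-closed subgroups of K^× such that X ≠ Y, X is strong in Y, and the extension X ⊆ Y is minimal: there is no root-closed subgroup Z of K^× with X ⊊ Z ⊊ Y such that X is strong in Z and Z is strong in Y. Then exactly one of the following holds: (1) (prealgebraic extension) there are an even integer n ≥ 2 and elements b₁, …, b_n ∈ Y ∩ G with rk(X·⟨b₁,…,b_n⟩) = rk(X) + n, such that Y is the root-closure of the subgroup generated by X and b₁, …, b_n, and 2·trdeg((b₁,…,b_n)/X) = n; (2) (green generic extension) there is b₀ ∈ (Y ∩ G) \ X transcendental over the subfield generated by X such that Y is the root-closure of the subgroup generated by X and b₀; (3) (algebraic extension) Y ∩ G = X ∩ G and there is b₀ ∈ Y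 \ X algebraic over the subfield generated by X such that Y is the root-closure of the subgroup generated by X and b₀; (4) (white generic extension) Y ∩ G = X ∩ G and there is b₀ ∈ Y \ X transcendental over the subfield generated by X such that Y is the root-closure of the subgroup generated by X and b₀. -/
noncomputable section

namespace GreenPoints

variable {K : Type*} [Field K] [CharZero K]

/-- The root-closure of a subgroup of `Kˣ`: the smallest root-closed subgroup containing it. -/
def rootClosure {K : Type*} [Field K] (S : Subgroup Kˣ) : Subgroup Kˣ :=
  sInf {T : Subgroup Kˣ | RootClosed T ∧ S ≤ T}

/-- The transcendence degree over a subfield `F` of `K` of the subfield `F(s)` generated by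
`F` and a subset `s` of `K`: the supremum of the cardinalities of subsets of `s` that are
algebraically independent over `F`. -/
def trdegOver {K : Type*} [Field K] (F : Subfield K) (s : Set K) : Cardinal :=
  ⨆ t : {t : Set K // t ⊆ s ∧ AlgebraicIndependent F ((↑) : t → K)}, Cardinal.mk t.1

/-- Prealgebraic extension: there are an even `n ≥ 2` and `b₁, …, b_n ∈ Y ∩ G` with
`rk(X·⟨b₁,…,b_n⟩) = rk(X) + n`, such that `Y` is the root-closure of the subgroup generated
by `X` and `b₁, …, b_n`, and `2·trdeg((b₁,…,b_n)/X) = n`. -/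
def PrealgebraicExt {K : Type*} [Field K] [CharZero K] (G X Y : Subgroup Kˣ) : Prop :=
  ∃ n : ℕ, 2 ≤ n ∧ Even n ∧ ∃ b : Fin n → Kˣ,
    (∀ i, b i ∈ Y ⊓ G) ∧
    grpRank (X ⊔ Subgroup.closure (Set.range b)) = grpRank X + n ∧
    Y = rootClosure (X ⊔ Subgroup.closure (Set.range b)) ∧
    2 * trdegOver (fieldOf X) (Set.range fun i => ((b i : Kˣ) : K)) = n

/-- Green generic extension: there is `b₀ ∈ (Y ∩ G) \ X` transcendental over the subfield
generated by `X` such that `Y` is the root-closure of the subgroup generated by `X` and `b₀`. -/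
def GreenGenericExt {K : Type*} [Field K] [CharZero K] (G X Y : Subgroup Kˣ) : Prop :=
  ∃ b₀ : Kˣ, b₀ ∈ Y ⊓ G ∧ b₀ ∉ X ∧ Transcendental (fieldOf X) ((b₀ : K)) ∧
    Y = rootClosure (X ⊔ Subgroup.closure {b₀})

/-- Algebraic extension: `Y ∩ G = X ∩ G` and there is `b₀ ∈ Y \ X` algebraic over the subfield
generated by `X` such that `Y` is the root-closure of the subgroup generated by `X` and `b₀`. -/
def AlgebraicExt {K : Type*} [Field K] [CharZero K] (G X Y : Subgroup Kˣ) : Prop :=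
  Y ⊓ G = X ⊓ G ∧ ∃ b₀ : Kˣ, b₀ ∈ Y ∧ b₀ ∉ X ∧ IsAlgebraic (fieldOf X) ((b₀ : K)) ∧
    Y = rootClosure (X ⊔ Subgroup.closure {b₀})

/-- White generic extension: `Y ∩ G = X ∩ G` and there is `b₀ ∈ Y \ X` transcendental over the
subfield generated by `X` such that `Y` is the root-closure of the subgroup generated by `X`
and `b₀`. -/
def WhiteGenericExt {K : Type*} [Field K] [CharZero K] (G X Y : Subgroup Kˣ) : Prop :=
  Y ⊓ G = X ⊓ G ∧ ∃ b₀ : Kˣ, b₀ ∈ Y ∧ b₀ ∉ X ∧ Transcendental (fieldOf X) ((b₀ : K)) ∧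
    Y = rootClosure (X ⊔ Subgroup.closure {b₀})

set_option linter.unusedSectionVars false

/-! ### Transcendence degree -/

open Cardinal in
theorem iSup_indep_eq {F : Type*} [Field F] [Algebra F K] {I s : Set K}
    (h : (AlgebraicIndependent.matroid F K).IsBasis I s) :
    (⨆ t : {t : Set K // t ⊆ s ∧ AlgebraicIndependent F ((↑) : t → K)}, #t.1) = #I := by
  apply le_antisymm
  · refine ciSup_le' fun t => ?_
    have ht : (AlgebraicIndependent.matroid F K).Indep t.1 := t.2.2
    exact ht.cardinalMk_le_isBasis h t.2.1
  · have hI : AlgebraicIndependent F ((↑) : I → K) := h.indep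
    exact le_ciSup_of_le (Cardinal.bddAbove_of_small) ⟨I, h.subset, hI⟩ le_rfl

/-- The field of elements algebraic over `s`. -/
def acl (s : Set K) : Subfield K :=
  { (Subalgebra.algebraicClosure (Algebra.adjoin ℚ s) K).toSubring with
    inv_mem' := fun x hx => by
      have : IsAlgebraic (Algebra.adjoin ℚ s) x := hx
      exact this.inv }

theorem mem_acl {s : Set K} {a : K} : a ∈ acl s ↔ IsAlgebraic (Algebra.adjoin ℚ s) a := Iff.rfl

theorem isAlgebraic_subring_mono {A B : Subring K} (h : A ≤ B) {a : K} (ha : IsAlgebraic A a) :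
    IsAlgebraic B a :=
  ha.ringHom_of_comp_eq (Subring.inclusion h) (RingHom.id K)
    (Subring.inclusion_injective h) rfl

theorem acl_flat {s : Set K} {a : K} (h : IsAlgebraic (acl s) a) : a ∈ acl s := by
  have h' : IsAlgebraic (Subalgebra.algebraicClosure (Algebra.adjoin ℚ s) K) a := h
  exact h'.restrictScalars (Algebra.adjoin ℚ s)

theorem subset_acl (s : Set K) : s ⊆ acl s := fun x hx =>
  mem_acl.2 (isAlgebraic_algebraMap (⟨x, Algebra.subset_adjoin hx⟩ : Algebra.adjoin ℚ s))

theorem fieldOf_le {X : Subgroup Kˣ} {L : Subfield K} (h : ∀ x ∈ X, (x : K) ∈ L) :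
    fieldOf X ≤ L := by
  refine Subfield.closure_le.2 ?_
  rintro _ ⟨x, hx, rfl⟩
  exact h x hx

theorem mem_fieldOf {X : Subgroup Kˣ} {x : Kˣ} (h : x ∈ X) : (x : K) ∈ fieldOf X :=
  Subfield.subset_closure ⟨x, h, rfl⟩

/-- Units algebraic over a subfield, as a subgroup. -/
def unitsAlg (L : Subfield K) : Subgroup Kˣ where
  carrier := {x | IsAlgebraic L (x : K)}
  mul_mem' := fun {a b} ha hb => by
    have ha' : IsAlgebraic L (a : K) := ha
    simpa using ha'.mul hb
  one_mem' := by simpa using isAlgebraic_one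
  inv_mem' := fun {a} ha => by
    have ha' : IsAlgebraic L (a : K) := ha
    simpa using ha'.inv

theorem mem_unitsAlg {L : Subfield K} {x : Kˣ} : x ∈ unitsAlg L ↔ IsAlgebraic L (x : K) := Iff.rfl

theorem rootClosed_unitsAlg (L : Subfield K) : RootClosed (unitsAlg L) := by
  intro x n hn h
  have h' : IsAlgebraic L ((x : K) ^ n) := by simpa using mem_unitsAlg.1 h
  exact h'.of_pow hn

theorem le_rootClosure (S : Subgroup Kˣ) : S ≤ rootClosure S :=
  le_sInf fun _ h => h.2

theorem rootClosure_le {S T : Subgroup Kˣ} (hT : RootClosed T) (h : S ≤ T) : rootClosure S ≤ T :=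
  sInf_le ⟨hT, h⟩

theorem rootClosed_rootClosure (S : Subgroup Kˣ) : RootClosed (rootClosure S) := by
  intro x n hn h
  refine Subgroup.mem_sInf.2 fun T hT => hT.1 x n hn (Subgroup.mem_sInf.1 h T hT)

open Cardinal in
theorem td_rootClosure (X : Subgroup Kˣ) (B : Set Kˣ) :
    td (rootClosure (X ⊔ Subgroup.closure B)) =
      td X + trdegOver (fieldOf X) (Units.val '' B) := by
  obtain ⟨I, hI⟩ := (AlgebraicIndependent.matroid ℚ K).exists_isBasis (Units.val '' (X : Set Kˣ))
  obtain ⟨J, hJ⟩ := (AlgebraicIndependent.matroid (fieldOf X) K).exists_isBasis (Units.val '' B)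
  have hI' := AlgebraicIndependent.matroid_isBasis_iff.1 hI
  have hJ' := AlgebraicIndependent.matroid_isBasis_iff.1 hJ
  have hIF : I ⊆ fieldOf X := fun x hx => Subfield.subset_closure (hI.subset hx)
  have hsum : AlgebraicIndependent ℚ (Sum.elim ((↑) : J → K) ((↑) : I → K)) := by
    have h1 : AlgebraicIndependent ℚ ((↑) : I → K) := hI'.1
    have h2 : AlgebraicIndependent (fieldOf X) ((↑) : J → K) := hJ'.1
    refine h1.sumElim_of_tower (S := fieldOf X) ?_ h2
    rintro _ ⟨x, rfl⟩
    exact ⟨⟨x, hIF x.2⟩, rfl⟩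
  have hinj := hsum.injective
  have hdisj : Disjoint I J := by
    rw [Set.disjoint_left]
    intro x hx hx'
    have := @hinj (Sum.inl ⟨x, hx'⟩) (Sum.inr ⟨x, hx⟩) rfl
    simp at this
  have hind : AlgebraicIndependent ℚ ((↑) : (I ∪ J : Set K) → K) := by
    have := hsum.to_subtype_range
    rw [Set.Sum.elim_range, Subtype.range_coe, Subtype.range_coe, Set.union_comm] at this
    exact this
  -- closure
  have hXacl : fieldOf X ≤ acl (I ∪ J) := by
    refine fieldOf_le fun x hx => ?_
    have h1 := hI'.2.2 (x : K) ⟨x, hx, rfl⟩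
    have hle : Algebra.adjoin ℚ I ≤ Algebra.adjoin ℚ (I ∪ J) :=
      Algebra.adjoin_mono Set.subset_union_left
    exact isAlgebraic_subring_mono (A := (Algebra.adjoin ℚ I).toSubring)
      (B := (Algebra.adjoin ℚ (I ∪ J)).toSubring) hle h1
  have hBacl : ∀ b ∈ B, (b : K) ∈ acl (I ∪ J) := by
    intro b hb
    have h1 := hJ'.2.2 (b : K) ⟨b, hb, rfl⟩
    apply acl_flat
    refine isAlgebraic_subring_mono (A := (Algebra.adjoin (fieldOf X) J).toSubring)
      (B := (acl (I ∪ J)).toSubring) ?_ h1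
    intro x hx'
    replace hx' : x ∈ Algebra.adjoin (fieldOf X) J := hx'
    show x ∈ acl (I ∪ J)
    induction hx' using Algebra.adjoin_induction with
    | mem x hx => exact subset_acl _ (Or.inr hx)
    | algebraMap r => exact hXacl r.2
    | add x y hx hy h1 h2 => exact add_mem h1 h2
    | mul x y hx hy h1 h2 => exact mul_mem h1 h2
  have hYacl : rootClosure (X ⊔ Subgroup.closure B) ≤ unitsAlg (acl (I ∪ J)) := by
    refine rootClosure_le (rootClosed_unitsAlg _) (sup_le ?_ ((Subgroup.closure_le _).2 ?_))
    · intro x hx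
      exact isAlgebraic_algebraMap (⟨x, hXacl (mem_fieldOf hx)⟩ : acl (I ∪ J))
    · intro x hx
      exact isAlgebraic_algebraMap (⟨x, hBacl x hx⟩ : acl (I ∪ J))
  have hbasis : (AlgebraicIndependent.matroid ℚ K).IsBasis (I ∪ J)
      (Units.val '' (rootClosure (X ⊔ Subgroup.closure B) : Set Kˣ)) := by
    refine AlgebraicIndependent.matroid_isBasis_iff.2 ⟨hind, ?_, ?_⟩
    · refine Set.union_subset ?_ ?_
      · exact hI.subset.trans (Set.image_mono fun x hx =>
          le_rootClosure _ (Subgroup.mem_sup_left hx))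
      · exact hJ.subset.trans (Set.image_mono fun x hx =>
          le_rootClosure _ (Subgroup.mem_sup_right (Subgroup.subset_closure hx)))
    · rintro _ ⟨x, hx, rfl⟩
      exact acl_flat (hYacl hx)
  rw [td, tdSet, iSup_indep_eq hbasis, td, tdSet, iSup_indep_eq hI, trdegOver, iSup_indep_eq hJ,
    Cardinal.mk_union_of_disjoint hdisj]

theorem td_mono {S T : Subgroup Kˣ} (h : S ≤ T) : td S ≤ td T := by
  refine ciSup_le' fun t => ?_
  exact le_ciSup_of_le (Cardinal.bddAbove_of_small)
    ⟨t.1, t.2.1.trans (Set.image_mono h), t.2.2⟩ le_rfl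

theorem trdegOver_singleton_le (F : Subfield K) (b : K) : trdegOver F {b} ≤ 1 := by
  refine ciSup_le' fun t => ?_
  simpa using Cardinal.mk_le_mk_of_subset t.2.1

theorem trdegOver_singleton_of_isAlgebraic (F : Subfield K) (b : K) (hb : IsAlgebraic F b) :
    trdegOver F {b} = 0 := by
  refine le_antisymm (ciSup_le' fun t => ?_) zero_le
  obtain ⟨t, ht, hi⟩ := t
  rcases Set.subset_singleton_iff_eq.1 ht with rfl | rfl
  · simp
  · exact absurd hb (hi.transcendental ⟨b, rfl⟩)

theorem trdegOver_empty (F : Subfield K) : trdegOver F (∅ : Set K) = 0 := by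
  refine le_antisymm (ciSup_le' fun t => ?_) zero_le
  obtain ⟨t, ht, hi⟩ := t
  rw [Set.subset_empty_iff] at ht
  subst ht
  simp

theorem td_rootClosure_self (X : Subgroup Kˣ) : td (rootClosure X) = td X := by
  have := td_rootClosure X ∅
  simpa [trdegOver_empty] using this

/-! ### Rank -/

/-- A subgroup of `Kˣ` as a ℤ-submodule of `Additive Kˣ`. -/
def sm (S : Subgroup Kˣ) : Submodule ℤ (Additive Kˣ) :=
  AddSubgroup.toIntSubmodule (Subgroup.toAddSubgroup S)

theorem mem_sm {S : Subgroup Kˣ} {x : Additive Kˣ} : x ∈ sm S ↔ x.toMul ∈ S := Iff.rfl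

theorem rank_sm (S : Subgroup Kˣ) : Module.rank ℤ (sm S) = grpRank S := by
  let e : Additive S ≃+ sm S :=
    { toFun := fun x => ⟨Additive.ofMul (x.toMul : Kˣ), x.toMul.2⟩
      invFun := fun x => Additive.ofMul ⟨x.1.toMul, x.2⟩
      left_inv := fun x => rfl
      right_inv := fun x => rfl
      map_add' := fun x y => rfl }
  exact (LinearEquiv.rank_eq e.toIntLinearEquiv).symm

theorem rank_sup_map {M : Type*} [AddCommGroup M] (P Q : Submodule ℤ M) :
    Module.rank ℤ (P ⊔ Q : Submodule ℤ M) =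
      Module.rank ℤ P + Module.rank ℤ (Q.map P.mkQ) := by
  have h := LinearMap.rank_range_add_rank_ker (P.mkQ.domRestrict (P ⊔ Q))
  rw [LinearMap.range_domRestrict, LinearMap.ker_domRestrict, Submodule.ker_mkQ,
    Submodule.map_sup] at h
  have h0 : P.map P.mkQ = ⊥ := by
    rw [eq_bot_iff]
    rintro _ ⟨x, hx, rfl⟩
    simpa using hx
  rw [h0, bot_sup_eq, (Submodule.comapSubtypeEquivOfLe (le_sup_left : P ≤ P ⊔ Q)).rank_eq] at h
  rw [← h, add_comm]

theorem sm_mono {A B : Subgroup Kˣ} (h : A ≤ B) : sm A ≤ sm B := fun _ hx => h hx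

theorem grpRank_eq_add {A B : Subgroup Kˣ} (h : A ≤ B) :
    grpRank B = grpRank A + Module.rank ℤ ((sm B).map (sm A).mkQ) := by
  rw [← rank_sm, ← rank_sm, ← rank_sup_map, sup_eq_right.2 (sm_mono h)]

theorem rank_map_eq_zero_iff {A B : Subgroup Kˣ} :
    Module.rank ℤ ((sm B).map (sm A).mkQ) = 0 ↔ ∀ x ∈ B, ∃ n : ℕ, 1 ≤ n ∧ x ^ n ∈ A := by
  rw [rank_eq_zero_iff]
  constructor
  · intro h x hx
    obtain ⟨a, ha, h0⟩ := h ⟨(sm A).mkQ (Additive.ofMul x), Submodule.mem_map_of_mem hx⟩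
    have h1 : (sm A).mkQ (a • Additive.ofMul x) = 0 := by
      rw [map_smul]; exact congrArg Subtype.val h0
    rw [Submodule.mkQ_apply, Submodule.Quotient.mk_eq_zero, mem_sm] at h1
    have h2 : x ^ a ∈ A := h1
    refine ⟨a.natAbs, Int.natAbs_pos.2 ha, ?_⟩
    rcases Int.natAbs_eq a with h | h
    · rw [← zpow_natCast, ← h]; exact h2
    · rw [h, zpow_neg, zpow_natCast] at h2
      simpa using h2
  · rintro h ⟨_, ⟨x, hx, rfl⟩⟩
    obtain ⟨n, hn, hx⟩ := h x.toMul hx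
    refine ⟨n, by omega, Subtype.ext ?_⟩
    change (n : ℤ) • (sm A).mkQ x = 0
    rw [← map_smul, Submodule.mkQ_apply, Submodule.Quotient.mk_eq_zero, mem_sm]
    simpa using hx

theorem grpRank_eq_of_pow {A B : Subgroup Kˣ} (h : A ≤ B)
    (hp : ∀ x ∈ B, ∃ n : ℕ, 1 ≤ n ∧ x ^ n ∈ A) : grpRank B = grpRank A := by
  rw [grpRank_eq_add h, rank_map_eq_zero_iff.2 hp, add_zero]

theorem exists_pow_of_grpRank_le {A B : Subgroup Kˣ} (h : A ≤ B) (hB : FiniteRank B)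
    (hr : grpRank B ≤ grpRank A) : ∀ x ∈ B, ∃ n : ℕ, 1 ≤ n ∧ x ^ n ∈ A := by
  rw [← rank_map_eq_zero_iff]
  have hA := hB.mono h
  unfold FiniteRank at hA hB
  rw [grpRank_eq_add h] at hr hB
  have h2 := (Cardinal.add_lt_aleph0_iff.1 hB).2
  obtain ⟨a, ha⟩ := Cardinal.lt_aleph0.1 hA
  obtain ⟨b, hb⟩ := Cardinal.lt_aleph0.1 h2
  rw [ha, hb] at hr
  rw [hb]
  norm_cast at hr ⊢
  omega

theorem mem_rootClosure {S : Subgroup Kˣ} {x : Kˣ} :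
    x ∈ rootClosure S ↔ ∃ n : ℕ, 1 ≤ n ∧ x ^ n ∈ S := by
  constructor
  · let T : Subgroup Kˣ :=
      { carrier := {x | ∃ n : ℕ, 1 ≤ n ∧ x ^ n ∈ S}
        mul_mem' := by
          rintro a b ⟨n, hn, ha⟩ ⟨m, hm, hb⟩
          refine ⟨n * m, Nat.mul_pos hn hm, ?_⟩
          rw [mul_pow]
          refine mul_mem ?_ ?_
          · rw [pow_mul]; exact pow_mem ha _
          · rw [mul_comm, pow_mul]; exact pow_mem hb _
        one_mem' := ⟨1, le_rfl, by simp⟩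
        inv_mem' := by
          rintro a ⟨n, hn, ha⟩
          exact ⟨n, hn, by simpa using ha⟩ }
    have hT : RootClosed T := by
      rintro x n hn ⟨m, hm, h⟩
      exact ⟨n * m, Nat.mul_pos hn hm, by rw [pow_mul]; exact h⟩
    intro hx
    exact rootClosure_le hT (fun y hy => ⟨1, le_rfl, by simpa using hy⟩ : S ≤ T) hx
  · rintro ⟨n, hn, h⟩
    exact rootClosed_rootClosure S x n hn (le_rootClosure S h)

theorem grpRank_rootClosure (S : Subgroup Kˣ) : grpRank (rootClosure S) = grpRank S :=
  grpRank_eq_of_pow (le_rootClosure S) fun _ hx => mem_rootClosure.1 hx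

theorem grpRank_rootClosure_inf (S G : Subgroup Kˣ) :
    grpRank (rootClosure S ⊓ G) = grpRank (S ⊓ G) :=
  grpRank_eq_of_pow (inf_le_inf_right _ (le_rootClosure S)) fun x hx => by
    obtain ⟨n, hn, h⟩ := mem_rootClosure.1 hx.1
    exact ⟨n, hn, h, pow_mem hx.2 n⟩

theorem sm_closure (B : Set Kˣ) :
    sm (Subgroup.closure B) = Submodule.span ℤ (Additive.toMul ⁻¹' B) := by
  rw [sm, Subgroup.toAddSubgroup_closure]
  exact (AddSubgroup.toIntSubmodule_closure _)

theorem sm_sup (A B : Subgroup Kˣ) : sm (A ⊔ B) = sm A ⊔ sm B := by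
  unfold sm
  rw [map_sup, map_sup]

theorem grpRank_sup_closure_range {n : ℕ} (X : Subgroup Kˣ) (b : Fin n → Kˣ) :
    grpRank (X ⊔ Subgroup.closure (Set.range b)) =
      grpRank X + Module.rank ℤ (Submodule.span ℤ
        (Set.range fun i => (sm X).mkQ (Additive.ofMul (b i)))) := by
  rw [← rank_sm, sm_sup, rank_sup_map, rank_sm, sm_closure, Submodule.map_span]
  have : (sm X).mkQ '' (Additive.toMul ⁻¹' Set.range b) =
      Set.range fun i => (sm X).mkQ (Additive.ofMul (b i)) := ?_
  · rw [this]
  ext y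
  constructor
  · rintro ⟨x, ⟨i, hi⟩, rfl⟩
    exact ⟨i, by simp only [hi]; rfl⟩
  · rintro ⟨i, rfl⟩
    exact ⟨Additive.ofMul (b i), ⟨i, rfl⟩, rfl⟩

/-- Multiplicative independence modulo a subgroup. -/
def IndepMod {n : ℕ} (X : Subgroup Kˣ) (b : Fin n → Kˣ) : Prop :=
  ∀ g : Fin n → ℤ, ∏ i, b i ^ g i ∈ X → ∀ i, g i = 0

theorem indepMod_iff {n : ℕ} (X : Subgroup Kˣ) (b : Fin n → Kˣ) :
    IndepMod X b ↔ LinearIndependent ℤ (fun i => (sm X).mkQ (Additive.ofMul (b i))) := by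
  rw [Fintype.linearIndependent_iff, IndepMod]
  refine forall_congr' fun g => imp_congr_left ?_
  have : ∑ i, g i • (sm X).mkQ (Additive.ofMul (b i)) =
      (sm X).mkQ (∑ i, g i • Additive.ofMul (b i)) := by simp
  rw [this, Submodule.mkQ_apply, Submodule.Quotient.mk_eq_zero, mem_sm]
  simp

theorem grpRank_sup_of_indepMod {n : ℕ} {X : Subgroup Kˣ} {b : Fin n → Kˣ} (h : IndepMod X b) :
    grpRank (X ⊔ Subgroup.closure (Set.range b)) = grpRank X + n := by
  rw [grpRank_sup_closure_range, rank_span ((indepMod_iff X b).1 h)]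
  have := Cardinal.mk_range_eq_of_injective ((indepMod_iff X b).1 h).injective
  rw [Cardinal.mk_fin, Cardinal.lift_natCast, Cardinal.lift_eq_nat_iff] at this
  rw [this]

theorem grpRank_sup_singleton_le (X : Subgroup Kˣ) (b : Kˣ) :
    grpRank (X ⊔ Subgroup.closure {b}) ≤ grpRank X + 1 := by
  have := grpRank_sup_closure_range X (fun _ : Fin 1 => b)
  rw [Set.range_const] at this
  rw [this]
  gcongr
  refine (rank_span_le _).trans ?_
  rw [Set.range_const]
  simp

theorem indepMod_singleton {X : Subgroup Kˣ} (hX : RootClosed X) {b : Kˣ} (hb : b ∉ X)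
    {Y : Subgroup Kˣ} (hY : Y ≤ X) : IndepMod Y (fun _ : Fin 1 => b) := by
  intro g hg i
  obtain rfl := Subsingleton.elim i 0
  by_contra h0
  have h1 : b ^ g 0 ∈ X := hY (by simpa using hg)
  apply hb
  refine hX b (g 0).natAbs (Int.natAbs_pos.2 h0) ?_
  rcases Int.natAbs_eq (g 0) with h | h
  · rw [← zpow_natCast, ← h]; exact h1
  · rw [h, zpow_neg, zpow_natCast] at h1
    simpa using h1

theorem grpRank_inf_add_one_le {G X : Subgroup Kˣ} (hX : RootClosed X) {b : Kˣ} (hb : b ∉ X)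
    (hbG : b ∈ G) {W : Subgroup Kˣ} (hXW : X ≤ W) (hbW : b ∈ W) :
    grpRank (X ⊓ G) + 1 ≤ grpRank (W ⊓ G) := by
  have h := grpRank_sup_of_indepMod (indepMod_singleton hX hb (inf_le_left : X ⊓ G ≤ X))
  rw [Nat.cast_one] at h
  rw [← h]
  refine grpRank_mono (sup_le (inf_le_inf_right _ hXW) ((Subgroup.closure_le _).2 ?_))
  rintro _ ⟨_, rfl⟩
  exact ⟨hbW, hbG⟩

theorem exists_indepMod {A B : Subgroup Kˣ} (h : A ≤ B) (hB : FiniteRank B) :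
    ∃ (n : ℕ) (b : Fin n → Kˣ), (∀ i, b i ∈ B) ∧ IndepMod A b ∧ grpRank B = grpRank A + n ∧
      ∀ x ∈ B, ∃ m : ℕ, 1 ≤ m ∧ x ^ m ∈ A ⊔ Subgroup.closure (Set.range b) := by
  have hadd := grpRank_eq_add h
  have hfin : Module.rank ℤ ((sm B).map (sm A).mkQ) < Cardinal.aleph0 := by
    unfold FiniteRank at hB
    rw [hadd] at hB
    exact (Cardinal.add_lt_aleph0_iff.1 hB).2
  obtain ⟨n, hn⟩ := Cardinal.lt_aleph0.1 hfin
  obtain ⟨s, hs, hli⟩ := exists_set_linearIndependent ℤ ((sm B).map (sm A).mkQ)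
  rw [hn] at hs
  obtain ⟨e⟩ : Nonempty (Fin n ≃ s) := by
    exact Cardinal.lift_mk_eq'.1 (by rw [hs]; simp)
  have hli2 : LinearIndependent ℤ (fun i => ((e i : _) : (sm B).map (sm A).mkQ)) :=
    LinearIndependent.comp hli e e.injective
  have hli3 : LinearIndependent ℤ (fun i => (((e i : _) : (sm B).map (sm A).mkQ) : _ ⧸ sm A)) :=
    hli2.map' ((sm B).map (sm A).mkQ).subtype (Submodule.ker_subtype _)
  have hex : ∀ i, ∃ x : Kˣ, x ∈ B ∧
      (sm A).mkQ (Additive.ofMul x) = ((e i : (sm B).map (sm A).mkQ) : _ ⧸ sm A) := by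
    intro i
    obtain ⟨x, hx, h⟩ := (e i : (sm B).map (sm A).mkQ).2
    exact ⟨x.toMul, hx, h⟩
  choose b hb hbe using hex
  have hind : IndepMod A b := by
    rw [indepMod_iff]
    convert! hli3 using 2 with i
    exact hbe i
  have hle : A ⊔ Subgroup.closure (Set.range b) ≤ B := by
    refine sup_le h ((Subgroup.closure_le _).2 ?_)
    rintro _ ⟨i, rfl⟩
    exact hb i
  refine ⟨n, b, hb, hind, by rw [hadd, hn], exists_pow_of_grpRank_le hle hB ?_⟩
  rw [grpRank_sup_of_indepMod hind, hadd, hn]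

theorem td_le_grpRank (S : Subgroup Kˣ) : td S ≤ grpRank S := by
  refine ciSup_le' ?_
  rintro ⟨t, ht, hi⟩
  have hex : ∀ x : t, ∃ u : S, ((u : Kˣ) : K) = x := by
    rintro ⟨x, hx⟩
    obtain ⟨u, hu, rfl⟩ := ht hx
    exact ⟨⟨u, hu⟩, rfl⟩
  choose u hu using hex
  have hli : LinearIndependent ℤ (fun x : t => (Additive.ofMul (u x) : Additive S)) := by
    rw [linearIndependent_iff']
    intro s g hg
    have h1 : ∏ i ∈ s, (u i) ^ g i = 1 := hg
    have h2 : ∏ i ∈ s, (i : K) ^ g i = 1 := by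
      have := congrArg (fun z : S => ((z : Kˣ) : K)) h1
      simpa [hu] using this
    have hne : ∀ i : t, (i : K) ≠ 0 := fun i => by rw [← hu]; exact Units.ne_zero _
    have h3 : ∏ i ∈ s, (i : K) ^ (g i).toNat = ∏ i ∈ s, (i : K) ^ (-g i).toNat := by
      have : (∏ i ∈ s, (i : K) ^ g i) * ∏ i ∈ s, (i : K) ^ (-g i).toNat =
          ∏ i ∈ s, (i : K) ^ (g i).toNat := by
        rw [← Finset.prod_mul_distrib]
        refine Finset.prod_congr rfl fun i _ => ?_
        rw [← zpow_natCast, ← zpow_natCast, ← zpow_add₀ (hne i)]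
        congr 1
        omega
      rw [← this, h2, one_mul]
    have key : ∀ f : t → ℕ, MvPolynomial.aeval ((↑) : t → K)
        (MvPolynomial.monomial (∑ i ∈ s, Finsupp.single i (f i)) (1 : ℚ)) =
          ∏ i ∈ s, (i : K) ^ f i := by
      intro f
      rw [MvPolynomial.monomial_sum_one, map_prod]
      refine Finset.prod_congr rfl fun i _ => ?_
      simp [MvPolynomial.aeval_monomial]
    have h4 : (MvPolynomial.monomial (∑ i ∈ s, Finsupp.single i ((g i).toNat)) (1 : ℚ)) =
        MvPolynomial.monomial (∑ i ∈ s, Finsupp.single i ((-g i).toNat)) (1 : ℚ) := by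
      apply hi
      rw [key (fun i => (g i).toNat), key (fun i => (-g i).toNat), h3]
    have h5 := MvPolynomial.monomial_left_injective (one_ne_zero) h4
    intro i hi'
    have h6 := DFunLike.congr_fun h5 i
    classical
    simp only [Finsupp.coe_finsetSum, Finset.sum_apply, Finsupp.single_apply] at h6
    simp [hi'] at h6
    omega
  exact hli.cardinal_le_rank

theorem FiniteRank.td {S : Subgroup Kˣ} (h : FiniteRank S) : td S < Cardinal.aleph0 :=
  (td_le_grpRank S).trans_lt h

/-! ### Predimension -/

theorem tdNat_mono {S T : Subgroup Kˣ} (hT : FiniteRank T) (h : S ≤ T) :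
    (td S).toNat ≤ (td T).toNat :=
  Cardinal.toNat_le_toNat (td_mono h) hT.td

theorem rkNat_mono {S T : Subgroup Kˣ} (hT : FiniteRank T) (h : S ≤ T) :
    (grpRank S).toNat ≤ (grpRank T).toNat :=
  Cardinal.toNat_le_toNat (grpRank_mono h) hT

theorem delta_rootClosure (G S : Subgroup Kˣ) : delta G (rootClosure S) = delta G S := by
  rw [delta, delta, td_rootClosure_self, grpRank_rootClosure_inf]

theorem rootClosed_inf_eq {X : Subgroup Kˣ} (hX : RootClosed X) : rootClosure X = X :=
  le_antisymm (rootClosure_le hX le_rfl) (le_rootClosure X)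

theorem StrongIn.mono {G X Z Y : Subgroup Kˣ} (h : StrongIn G X Y) (hZ : Z ≤ Y) :
    StrongIn G X Z := fun W hW hXW hWZ => h W hW hXW (hWZ.trans hZ)

section Classification

variable {G X Y : Subgroup Kˣ}

theorem eq_of_strong (hXY : X ≤ Y) (hstr : StrongIn G X Y)
    (hmin : ¬ ∃ Z : Subgroup Kˣ, RootClosed Z ∧ X < Z ∧ Z < Y ∧
      StrongIn G X Z ∧ StrongIn G Z Y) {Z : Subgroup Kˣ} (hZ : RootClosed Z) (hXZ : X ≤ Z)
    (hZY : Z ≤ Y) (hne : X ≠ Z) (hs : StrongIn G Z Y) : Z = Y := by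
  by_contra h
  exact hmin ⟨Z, hZ, lt_of_le_of_ne hXZ hne, lt_of_le_of_ne hZY h, hstr.mono hZY, hs⟩

/-- A subgroup containing all green points of `Y` is strong in `Y`. -/
theorem strongIn_of_inf_le {Z : Subgroup Kˣ} (hY : FiniteRank Y) (h : Y ⊓ G ≤ Z) :
    StrongIn G Z Y := by
  intro W hW hZW hWY
  have h1 := tdNat_mono hW hZW
  have h2 : W ⊓ G ≤ Z ⊓ G := le_inf ((inf_le_inf_right _ hWY).trans h) inf_le_right
  have h3 : (grpRank (W ⊓ G)).toNat ≤ (grpRank (Z ⊓ G)).toNat :=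
    rkNat_mono ((hW.mono hZW).mono inf_le_left) h2
  unfold delta
  omega

theorem white_case (hYfr : FiniteRank Y) (hYrc : RootClosed Y) (hXY : X ≤ Y) (hne : X ≠ Y)
    (hstr : StrongIn G X Y)
    (hmin : ¬ ∃ Z : Subgroup Kˣ, RootClosed Z ∧ X < Z ∧ Z < Y ∧
      StrongIn G X Z ∧ StrongIn G Z Y) (hG : Y ⊓ G ≤ X) :
    AlgebraicExt G X Y ∨ WhiteGenericExt G X Y := by
  have heq : Y ⊓ G = X ⊓ G := le_antisymm (le_inf hG inf_le_right) (inf_le_inf_right _ hXY)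
  obtain ⟨b, hbY, hbX⟩ := SetLike.exists_of_lt (lt_of_le_of_ne hXY hne)
  have hZ : rootClosure (X ⊔ Subgroup.closure {b}) = Y := by
    have hXZ : X ≤ rootClosure (X ⊔ Subgroup.closure {b}) := le_sup_left.trans (le_rootClosure _)
    refine eq_of_strong hXY hstr hmin (rootClosed_rootClosure _) hXZ ?_ ?_ ?_
    · refine rootClosure_le hYrc (sup_le hXY ((Subgroup.closure_le _).2 ?_))
      simpa using hbY
    · intro h
      apply hbX
      rw [h]
      exact le_rootClosure _ (Subgroup.mem_sup_right (Subgroup.mem_closure_singleton_self b))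
    · exact strongIn_of_inf_le hYfr (hG.trans hXZ)
  by_cases halg : IsAlgebraic (fieldOf X) (b : K)
  · exact Or.inl ⟨heq, b, hbY, hbX, halg, hZ.symm⟩
  · exact Or.inr ⟨heq, b, hbY, hbX, halg, hZ.symm⟩

theorem prealgebraic_case (hXfr : FiniteRank X) (hYfr : FiniteRank Y) (hXrc : RootClosed X)
    (hYrc : RootClosed Y) (hXY : X ≤ Y) (hstr : StrongIn G X Y)
    (hmin : ¬ ∃ Z : Subgroup Kˣ, RootClosed Z ∧ X < Z ∧ Z < Y ∧
      StrongIn G X Z ∧ StrongIn G Z Y) {c : Kˣ} (hc : c ∈ Y ⊓ G) (hcX : c ∉ X)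
    (hdelta : delta G Y = delta G X) : PrealgebraicExt G X Y := by
  have hZ : rootClosure (X ⊔ (Y ⊓ G)) = Y := by
    have hGZ : Y ⊓ G ≤ rootClosure (X ⊔ (Y ⊓ G)) := le_sup_right.trans (le_rootClosure _)
    refine eq_of_strong hXY hstr hmin (rootClosed_rootClosure _)
      (le_sup_left.trans (le_rootClosure _)) ?_ ?_ (strongIn_of_inf_le hYfr hGZ)
    · exact rootClosure_le hYrc (sup_le hXY inf_le_left)
    · intro h
      apply hcX
      rw [h]
      exact hGZ hc
  obtain ⟨n, b, hb, hind, hrk, hpow⟩ := exists_indepMod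
    (inf_le_inf_right G hXY : X ⊓ G ≤ Y ⊓ G) (hYfr.mono inf_le_left)
  have hindX : IndepMod X b := fun g hg =>
    hind g ⟨hg, G.prod_mem fun i _ => G.zpow_mem (hb i).2 _⟩
  have hYeq : Y = rootClosure (X ⊔ Subgroup.closure (Set.range b)) := by
    apply le_antisymm
    · rw [← hZ]
      refine rootClosure_le (rootClosed_rootClosure _)
        (sup_le (le_sup_left.trans (le_rootClosure _)) fun x hx => ?_)
      obtain ⟨m, hm, h⟩ := hpow x hx
      have hle : X ⊓ G ⊔ Subgroup.closure (Set.range b) ≤ X ⊔ Subgroup.closure (Set.range b) :=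
        sup_le_sup_right inf_le_left _
      exact mem_rootClosure.2 ⟨m, hm, hle h⟩
    · refine rootClosure_le hYrc (sup_le hXY ((Subgroup.closure_le _).2 ?_))
      rintro _ ⟨i, rfl⟩
      exact (hb i).1
  have htd := td_rootClosure X (Set.range b)
  rw [← hYeq, ← Set.range_comp] at htd
  change td Y = td X + trdegOver (fieldOf X) (Set.range fun i => ((b i : Kˣ) : K)) at htd
  have hone := grpRank_inf_add_one_le hXrc hcX hc.2 hXY hc.1
  have hXtd := hXfr.td
  have hYtd := hYfr.td
  have hXG : grpRank (X ⊓ G) < Cardinal.aleph0 := hXfr.mono inf_le_left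
  rw [htd] at hYtd
  obtain ⟨x, hx⟩ := Cardinal.lt_aleph0.1 hXtd
  obtain ⟨k, hk⟩ := Cardinal.lt_aleph0.1 (Cardinal.add_lt_aleph0_iff.1 hYtd).2
  obtain ⟨r, hr⟩ := Cardinal.lt_aleph0.1 hXG
  rw [hr] at hrk
  rw [hr, hrk] at hone
  rw [hx, hk] at htd
  unfold delta at hdelta
  rw [htd, hx, hrk, hr] at hdelta
  norm_cast at hone
  rw [← Nat.cast_add, ← Nat.cast_add] at hdelta
  simp only [Cardinal.toNat_natCast] at hdelta
  have hnk : n = 2 * k := by push_cast at hdelta; omega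
  refine ⟨n, by omega, ⟨k, by omega⟩, b, hb, grpRank_sup_of_indepMod hindX, hYeq, ?_⟩
  rw [hk, hnk]
  norm_cast

theorem green_case (hXfr : FiniteRank X) (hYfr : FiniteRank Y) (hXrc : RootClosed X)
    (hYrc : RootClosed Y) (hXY : X ≤ Y) (hstr : StrongIn G X Y)
    (hmin : ¬ ∃ Z : Subgroup Kˣ, RootClosed Z ∧ X < Z ∧ Z < Y ∧
      StrongIn G X Z ∧ StrongIn G Z Y) {c : Kˣ} (hc : c ∈ Y ⊓ G) (hcX : c ∉ X) :
    PrealgebraicExt G X Y ∨ GreenGenericExt G X Y := by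
  have hXZ : X ≤ rootClosure (X ⊔ Subgroup.closure {c}) := le_sup_left.trans (le_rootClosure _)
  have hcZ : c ∈ rootClosure (X ⊔ Subgroup.closure {c}) :=
    le_rootClosure _ (Subgroup.mem_sup_right (Subgroup.mem_closure_singleton_self c))
  have hZY : rootClosure (X ⊔ Subgroup.closure {c}) ≤ Y := by
    refine rootClosure_le hYrc (sup_le hXY ((Subgroup.closure_le _).2 ?_))
    simpa using hc.1
  have hZfr := hYfr.mono hZY
  have htd := td_rootClosure X {c}
  rw [Set.image_singleton] at htd
  have hle := trdegOver_singleton_le (fieldOf X) (c : K)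
  have hone := Cardinal.toNat_le_toNat
    (grpRank_inf_add_one_le hXrc hcX hc.2 hXZ hcZ) (hZfr.mono inf_le_left)
  have hXG : grpRank (X ⊓ G) < Cardinal.aleph0 := hXfr.mono inf_le_left
  rw [Cardinal.toNat_add hXG Cardinal.one_lt_aleph0, map_one] at hone
  have htd2 := congrArg Cardinal.toNat htd
  rw [Cardinal.toNat_add hXfr.td (hle.trans_lt Cardinal.one_lt_aleph0)] at htd2
  have hle2 := Cardinal.toNat_le_toNat hle Cardinal.one_lt_aleph0
  rw [map_one] at hle2
  have hsZ := hstr _ hZfr hXZ hZY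
  have htr : Transcendental (fieldOf X) (c : K) := by
    intro halg
    rw [trdegOver_singleton_of_isAlgebraic _ _ halg, map_zero] at htd2
    unfold delta at hsZ
    omega
  by_cases hs : StrongIn G (rootClosure (X ⊔ Subgroup.closure {c})) Y
  · right
    refine ⟨c, hc, hcX, htr, (eq_of_strong hXY hstr hmin (rootClosed_rootClosure _) hXZ hZY
      ?_ hs).symm⟩
    intro h
    apply hcX
    rw [h]
    exact hcZ
  · left
    unfold StrongIn at hs
    push Not at hs
    obtain ⟨W, hW, hZW, hWY, hlt⟩ := hs
    have hXW := hstr W hW (hXZ.trans hZW) hWY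
    have hWX : delta G W = delta G X := by
      unfold delta at hlt hXW hsZ ⊢
      omega
    have hWrc : rootClosure W = Y := by
      refine eq_of_strong hXY hstr hmin (rootClosed_rootClosure _)
        ((hXZ.trans hZW).trans (le_rootClosure _)) (rootClosure_le hYrc hWY) ?_ ?_
      · intro h
        apply hcX
        rw [h]
        exact le_rootClosure _ (hZW hcZ)
      · intro V hV hWV hVY
        rw [delta_rootClosure, hWX]
        exact hstr V hV (((hXZ.trans hZW).trans (le_rootClosure _)).trans hWV) hVY
    refine prealgebraic_case hXfr hYfr hXrc hYrc hXY hstr hmin hc hcX ?_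
    rw [← hWrc, delta_rootClosure, hWX]

theorem not_prealg_of_inf_eq (hXfr : FiniteRank X) (h : Y ⊓ G = X ⊓ G) :
    ¬ PrealgebraicExt G X Y := by
  rintro ⟨n, hn, -, b, hb, hrk, -, -⟩
  have : X ⊔ Subgroup.closure (Set.range b) = X := by
    refine sup_eq_left.2 ((Subgroup.closure_le _).2 ?_)
    rintro _ ⟨i, rfl⟩
    have := hb i
    rw [h] at this
    exact this.1
  rw [this] at hrk
  obtain ⟨r, hr⟩ := Cardinal.lt_aleph0.1 hXfr
  rw [hr] at hrk
  norm_cast at hrk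
  omega

theorem not_prealg_and_green (hXfr : FiniteRank X) :
    ¬ (PrealgebraicExt G X Y ∧ GreenGenericExt G X Y) := by
  rintro ⟨⟨n, hn, -, b, hb, hrk, hY, -⟩, c, -, -, -, hY'⟩
  have h1 := grpRank_sup_singleton_le X c
  rw [← grpRank_rootClosure, ← hY', hY, grpRank_rootClosure, hrk] at h1
  obtain ⟨r, hr⟩ := Cardinal.lt_aleph0.1 hXfr
  rw [hr] at h1
  norm_cast at h1
  omega

theorem not_green_of_inf_eq (h : Y ⊓ G = X ⊓ G) : ¬ GreenGenericExt G X Y := by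
  rintro ⟨b, hb, hbX, -⟩
  rw [h] at hb
  exact hbX hb.1

theorem not_alg_and_white : ¬ (AlgebraicExt G X Y ∧ WhiteGenericExt G X Y) := by
  rintro ⟨⟨-, b, -, -, hb, hY⟩, -, c, hc, -, hct, -⟩
  apply hct
  have : Y ≤ unitsAlg (fieldOf X) := by
    rw [hY]
    refine rootClosure_le (rootClosed_unitsAlg _) (sup_le ?_ ((Subgroup.closure_le _).2 ?_))
    · intro x hx
      exact isAlgebraic_algebraMap (⟨x, mem_fieldOf hx⟩ : fieldOf X)
    · rintro _ rfl
      exact hb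
  exact this hc

end Classification

/-- Classification of minimal strong extensions: if `K` is algebraically closed of
characteristic zero, `G` is a divisible subgroup of `Kˣ`, and `X ⊆ Y` are finite-rank
root-closed subgroups with `X ≠ Y`, `X` strong in `Y`, and the extension minimal (no
intermediate root-closed `Z` with `X ⊊ Z ⊊ Y`, `X` strong in `Z` and `Z` strong in `Y`),
then exactly one of the four cases (prealgebraic, green generic, algebraic, white generic)
holds. -/
theorem minimal_strong_extension_classification
    {K : Type*} [Field K] [IsAlgClosed K] [CharZero K]
    (G : Subgroup Kˣ) (hGdiv : ∀ x ∈ G, ∀ n : ℕ, 1 ≤ n → ∃ y ∈ G, y ^ n = x)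
    (X Y : Subgroup Kˣ) (hXfr : FiniteRank X) (hYfr : FiniteRank Y)
    (hXrc : RootClosed X) (hYrc : RootClosed Y) (hXY : X ≤ Y) (hne : X ≠ Y)
    (hstr : StrongIn G X Y)
    (hmin : ¬ ∃ Z : Subgroup Kˣ, RootClosed Z ∧ X < Z ∧ Z < Y ∧
      StrongIn G X Z ∧ StrongIn G Z Y) :
    (PrealgebraicExt G X Y ∨ GreenGenericExt G X Y ∨ AlgebraicExt G X Y ∨
      WhiteGenericExt G X Y) ∧
    ¬(PrealgebraicExt G X Y ∧ GreenGenericExt G X Y) ∧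
    ¬(PrealgebraicExt G X Y ∧ AlgebraicExt G X Y) ∧
    ¬(PrealgebraicExt G X Y ∧ WhiteGenericExt G X Y) ∧
    ¬(GreenGenericExt G X Y ∧ AlgebraicExt G X Y) ∧
    ¬(GreenGenericExt G X Y ∧ WhiteGenericExt G X Y) ∧
    ¬(AlgebraicExt G X Y ∧ WhiteGenericExt G X Y) := by
  refine ⟨?_, not_prealg_and_green hXfr, fun h => not_prealg_of_inf_eq hXfr h.2.1 h.1,
    fun h => not_prealg_of_inf_eq hXfr h.2.1 h.1, fun h => not_green_of_inf_eq h.2.1 h.1,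
    fun h => not_green_of_inf_eq h.2.1 h.1, not_alg_and_white⟩
  by_cases hG : Y ⊓ G ≤ X
  · rcases white_case hYfr hYrc hXY hne hstr hmin hG with h | h
    · exact Or.inr (Or.inr (Or.inl h))
    · exact Or.inr (Or.inr (Or.inr h))
  · obtain ⟨c, hc, hcX⟩ := SetLike.not_le_iff_exists.1 hG
    rcases green_case hXfr hYfr hXrc hYrc hXY hstr hmin hc hcX with h | h
    · exact Or.inl h
    · exact Or.inr (Or.inl h)

end GreenPoints

end
end
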